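/- arXiv:2211.12397 — 7 statements merged into one kernel-verified Lean document; each statement's English description precedes it below -/
import Mathlib

section
/- For every sequence (s_k) of positive integers and all indices 1 ≤ i ≤ j, writing n = |α_i^{(s)}|: n divides |α_j^{(s)}|, and for every k with (k+1)·n ≤ |α_j^{(s)}|, the contiguous block of α_j^{(s)} of length n starting at position k·n (i.e. ((α_j^{(s)}).drop (k·n)).take n) equals either α_i^{(s)} or its complement ᾱ_i^{(s)}. In particular, α_j^{(s)} is a concatenation of copies of α_i^{(s)} and ᾱ_i^{(s)}. -/
/-- The complement of a binary word: negate every letter. -/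
def wordCompl (w : List Bool) : List Bool := w.map Bool.not

/-- `wordPow u k` is the concatenation of `k` copies of `u`. -/
def wordPow (u : List Bool) (k : ℕ) : List Bool := (List.replicate k u).flatten

/-- Pouzet's words `α_i^{(s)}`: `α_1 = [0,1]`, `α_{i+1} = α_i^{s_i} ++ ᾱ_i^{s_i}`. -/
def alphaWord (s : ℕ → ℕ) : ℕ → List Bool
  | 0 => []
  | 1 => [false, true]
  | (i + 2) => wordPow (alphaWord s (i + 1)) (s (i + 1)) ++
      wordPow (wordCompl (alphaWord s (i + 1))) (s (i + 1))

/-- The language `L^{(s)}` of all factors of the words `α_i^{(s)}`, `i ≥ 1`. -/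
def langL (s : ℕ → ℕ) : Set (List Bool) :=
  {w | ∃ i, 1 ≤ i ∧ w <:+: alphaWord s i}



def IsBlk (u w : List Bool) : Prop :=
  ∃ L : List (List Bool), (∀ x ∈ L, x = u ∨ x = wordCompl u) ∧ w = L.flatten

theorem wordCompl_invol (u : List Bool) : wordCompl (wordCompl u) = u := by
  simp [wordCompl, Function.comp_def]

theorem wordCompl_len (u : List Bool) : (wordCompl u).length = u.length := by
  simp [wordCompl]

theorem IsBlk.app {u v w : List Bool} (h : IsBlk u v) (h' : IsBlk u w) : IsBlk u (v ++ w) := by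
  obtain ⟨L, hL, rfl⟩ := h
  obtain ⟨M, hM, rfl⟩ := h'
  refine ⟨L ++ M, ?_, by simp⟩
  intro x hx
  rcases List.mem_append.1 hx with h | h
  · exact hL x h
  · exact hM x h

theorem IsBlk.pow {u v : List Bool} (h : IsBlk u v) (k : ℕ) : IsBlk u (wordPow v k) := by
  induction k with
  | zero => exact ⟨[], by simp, by simp [wordPow]⟩
  | succ k ih =>
    have : wordPow v (k + 1) = v ++ wordPow v k := by simp [wordPow, List.replicate_succ]
    rw [this]
    exact h.app ih

theorem IsBlk.compl {u v : List Bool} (h : IsBlk u v) : IsBlk u (wordCompl v) := by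
  obtain ⟨L, hL, rfl⟩ := h
  refine ⟨L.map wordCompl, ?_, ?_⟩
  · intro x hx
    obtain ⟨y, hy, rfl⟩ := List.mem_map.1 hx
    rcases hL y hy with h | h
    · right; rw [h]
    · left; rw [h, wordCompl_invol]
  · unfold wordCompl
    rw [List.map_flatten]

theorem isBlk_alpha (s : ℕ → ℕ) (i j : ℕ) (hi : 1 ≤ i) (hij : i ≤ j) :
    IsBlk (alphaWord s i) (alphaWord s j) := by
  induction j, hij using Nat.le_induction with
  | base => exact ⟨[alphaWord s i], by simp, by simp⟩
  | succ j hj ih =>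
    obtain ⟨m, rfl⟩ : ∃ m, j = m + 1 := ⟨j - 1, by omega⟩
    rw [alphaWord]
    exact (ih.pow _).app (ih.compl.pow _)

theorem alpha_pos (s : ℕ → ℕ) (hs : ∀ k, 0 < s k) (i : ℕ) :
    0 < (alphaWord s (i + 1)).length := by
  induction i with
  | zero => simp [alphaWord]
  | succ i ih =>
    have := Nat.mul_pos (hs (i + 1)) ih
    rw [alphaWord]
    simp only [wordPow, List.length_append, List.length_flatten, List.map_replicate,
      List.sum_replicate, smul_eq_mul]
    omega

theorem flat_len (n : ℕ) (L : List (List Bool)) (hL : ∀ x ∈ L, x.length = n) :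
    L.flatten.length = L.length * n := by
  induction L with
  | nil => simp
  | cons a L ih =>
    have h1 := hL a (by simp)
    have h2 := ih (fun x hx => hL x (by simp [hx]))
    rw [List.flatten_cons, List.length_append, h1, h2, List.length_cons]
    ring

theorem flat_blk (n : ℕ) (L : List (List Bool)) (hL : ∀ x ∈ L, x.length = n) (k : ℕ)
    (hk : k < L.length) : (L.flatten.drop (k * n)).take n ∈ L := by
  induction L generalizing k with
  | nil => simp at hk
  | cons a L ih =>
    have h1 := hL a (by simp)
    cases k with
    | zero => subst h1; simp
    | succ k =>
      have h2 := ih (fun x hx => hL x (by simp [hx])) k (by simpa using hk)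
      have : (a :: L).flatten.drop ((k + 1) * n) = L.flatten.drop (k * n) := by
        rw [List.flatten_cons, show (k + 1) * n = a.length + k * n by rw [h1]; ring,
          List.drop_append]
        simp
      rw [this]
      exact List.mem_cons_of_mem _ h2

theorem alphaWord_blocks (s : ℕ → ℕ) (hs : ∀ k, 0 < s k) (i j : ℕ) (hi : 1 ≤ i)
    (hij : i ≤ j) :
    (alphaWord s i).length ∣ (alphaWord s j).length ∧
      ∀ k : ℕ, (k + 1) * (alphaWord s i).length ≤ (alphaWord s j).length →
        ((alphaWord s j).drop (k * (alphaWord s i).length)).take (alphaWord s i).length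
            = alphaWord s i ∨
        ((alphaWord s j).drop (k * (alphaWord s i).length)).take (alphaWord s i).length
            = wordCompl (alphaWord s i) := by
  obtain ⟨L, hL, hw⟩ := isBlk_alpha s i j hi hij
  have hlen : ∀ x ∈ L, x.length = (alphaWord s i).length := by
    intro x hx
    rcases hL x hx with h | h
    · rw [h]
    · rw [h, wordCompl_len]
  have hpos : 0 < (alphaWord s i).length := by
    obtain ⟨m, rfl⟩ : ∃ m, i = m + 1 := ⟨i - 1, by omega⟩
    exact alpha_pos s hs m
  have hfl := flat_len _ L hlen
  rw [hw]
  refine ⟨⟨L.length, by rw [hfl, mul_comm]⟩, ?_⟩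
  intro k hk
  rw [hfl] at hk
  exact hL _ (flat_blk _ L hlen k (Nat.le_of_mul_le_mul_right hk hpos))
end

section
/- For every sequence (s_k) of positive integers, the language L^{(s)} is well-quasi-ordered under the factor order: for every function f : ℕ → List Bool with f n ∈ L^{(s)} for all n, there exist indices m < n such that f m is a factor (List.IsInfix) of f n. Equivalently, L^{(s)} is Set.PartiallyWellOrderedOn with respect to the infix relation (· <:+: ·). -/
theorem aux_block {m : ℕ} (w : List Bool) (hw : 2 * m < w.length) (Ls : List (List Bool))
    (hL : ∀ b ∈ Ls, b.length = m) (h : w <:+: Ls.flatten) : ∃ b ∈ Ls, b <:+: w := by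
  induction Ls with
  | nil =>
    have := h.length_le
    simp at this
    subst this
    simp at hw
  | cons b Ls ih =>
    by_cases hF : w <:+: Ls.flatten
    · obtain ⟨c, hc, hcw⟩ := ih (fun c hc => hL c (List.mem_cons_of_mem _ hc)) hF
      exact ⟨c, List.mem_cons_of_mem _ hc, hcw⟩
    have hb := hL b (by simp)
    obtain ⟨p, q, h⟩ := h
    rw [List.flatten_cons, List.append_assoc, List.append_eq_append_iff] at h
    rcases h with ⟨a, h1, h2⟩ | ⟨a, h1, h2⟩
    · rw [List.append_eq_append_iff] at h2
      have hal : a.length ≤ m := by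
        rw [← hb, h1]; simp
      rcases h2 with ⟨c, h3, h4⟩ | ⟨c, h3, h4⟩
      · rw [h3] at hal
        simp at hal
        omega
      · cases Ls with
        | nil =>
          simp at h4
          rw [h3, h4.1] at hw
          simp at hw
          omega
        | cons d Ls =>
          have hd := hL d (by simp)
          refine ⟨d, by simp, ?_⟩
          have hdc : d <+: c := by
            refine List.prefix_of_prefix_length_le (l₃ := (d :: Ls).flatten) ?_ ?_ ?_
            · simp
            · rw [h4]; simp
            · rw [h3] at hw
              simp at hw
              omega
          rw [h3]
          exact hdc.isInfix.trans (List.suffix_append _ _).isInfix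
    · exact absurd ⟨a, q, by rw [h2, List.append_assoc]⟩ hF

def AuxP (A w : List Bool) : Prop :=
  ∃ Ls : List (List Bool), (∀ b ∈ Ls, b = A ∨ b = wordCompl A) ∧ w = Ls.flatten

theorem aux_cc (A : List Bool) : wordCompl (wordCompl A) = A := by
  simp [wordCompl, Function.comp_def]

theorem AuxP.app {A v w : List Bool} (hv : AuxP A v) (hw : AuxP A w) : AuxP A (v ++ w) := by
  obtain ⟨L, h1, rfl⟩ := hv
  obtain ⟨M, h2, rfl⟩ := hw
  refine ⟨L ++ M, ?_, by simp⟩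
  intro b hb
  rcases List.mem_append.1 hb with h | h
  · exact h1 b h
  · exact h2 b h

theorem AuxP.pow {A v : List Bool} (hv : AuxP A v) (k : ℕ) : AuxP A (wordPow v k) := by
  induction k with
  | zero => exact ⟨[], by simp, by simp [wordPow]⟩
  | succ k ih =>
    have : wordPow v (k+1) = v ++ wordPow v k := by simp [wordPow, List.replicate_succ]
    rw [this]
    exact hv.app ih

theorem AuxP.compl {A v : List Bool} (hv : AuxP A v) : AuxP A (wordCompl v) := by
  obtain ⟨L, h1, rfl⟩ := hv
  refine ⟨L.map wordCompl, ?_, ?_⟩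
  · intro b hb
    obtain ⟨c, hc, rfl⟩ := List.mem_map.1 hb
    rcases h1 c hc with rfl | rfl
    · right; rfl
    · left; exact aux_cc A
  · simp only [wordCompl, List.map_flatten]
    rfl

theorem aux_alpha (s : ℕ → ℕ) (j k : ℕ) :
    AuxP (alphaWord s (j + 1)) (alphaWord s (j + 1 + k)) := by
  induction k with
  | zero => exact ⟨[alphaWord s (j + 1)], by simp, by simp⟩
  | succ k ih =>
    have : j + 1 + (k + 1) = (j + k) + 2 := by omega
    rw [this, alphaWord]
    have e : j + 1 + k = j + k + 1 := by omega
    rw [e] at ih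
    exact (ih.pow _).app (ih.compl.pow _)

theorem aux_pow_infix (v : List Bool) (k : ℕ) (hk : 0 < k) : v <:+: wordPow v k := by
  obtain ⟨n, rfl⟩ := Nat.exists_eq_succ_of_ne_zero hk.ne'
  simp only [wordPow, List.replicate_succ, List.flatten_cons]
  exact (List.prefix_append _ _).isInfix

theorem aux_step (s : ℕ → ℕ) (hs : ∀ k, 0 < s k) (i : ℕ) :
    alphaWord s (i + 1) <:+: alphaWord s (i + 2) ∧
    wordCompl (alphaWord s (i + 1)) <:+: alphaWord s (i + 2) := by
  rw [alphaWord]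
  exact ⟨(aux_pow_infix _ _ (hs _)).trans (List.prefix_append _ _).isInfix,
    (aux_pow_infix _ _ (hs _)).trans (List.suffix_append _ _).isInfix⟩

theorem aux_mono (s : ℕ → ℕ) (hs : ∀ k, 0 < s k) (i k : ℕ) :
    alphaWord s (i + 1) <:+: alphaWord s (i + 1 + k) := by
  induction k with
  | zero => exact List.infix_refl _
  | succ k ih =>
    have e := (aux_step s hs (i + k)).1
    rw [show i + k + 1 = i + 1 + k by omega, show i + k + 2 = i + 1 + (k + 1) by omega] at e
    exact ih.trans e

theorem aux_rec (s : ℕ → ℕ) (hs : ∀ k, 0 < s k) (u : List Bool) (hu : u ∈ langL s) :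
    ∃ N, ∀ w ∈ langL s, N < w.length → u <:+: w := by
  obtain ⟨i, hi, hu⟩ := hu
  obtain ⟨j, rfl⟩ := Nat.exists_eq_add_of_le' hi
  refine ⟨2 * (alphaWord s (j + 2)).length, ?_⟩
  rintro w ⟨k, hk, hw⟩ hl
  obtain ⟨k, rfl⟩ := Nat.exists_eq_add_of_le' hk
  have hw2 := hw.trans (aux_mono s hs k (j + 1))
  obtain ⟨L, hL, he⟩ := aux_alpha s (j + 1) k
  rw [show k + 1 + (j + 1) = j + 1 + 1 + k by omega, he] at hw2
  obtain ⟨b, hb, hbw⟩ := aux_block w hl L (by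
    intro b hb
    rcases hL b hb with rfl | rfl <;> simp [wordCompl]) hw2
  refine List.IsInfix.trans ?_ hbw
  refine hu.trans ?_
  rcases hL b hb with rfl | rfl
  · exact (aux_step s hs j).1
  · have := (aux_step s hs j).2.map Bool.not
    change wordCompl (wordCompl _) <:+: _ at this
    rw [aux_cc] at this
    exact this

theorem aux_main (s : ℕ → ℕ) (hs : ∀ k, 0 < s k) (f : ℕ → List Bool)
    (hf : ∀ n, f n ∈ langL s) : ∃ m n, m < n ∧ f m <:+: f n := by
  obtain ⟨N, hN⟩ := aux_rec s hs (f 0) (hf 0)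
  by_cases h : ∃ n, 0 < n ∧ N < (f n).length
  · obtain ⟨n, h0, h⟩ := h
    exact ⟨0, n, h0, hN _ (hf n) h⟩
  · push Not at h
    have hfin := List.finite_length_le Bool N
    have : Finite {l : List Bool | l.length ≤ N} := hfin
    obtain ⟨a, b, hab, he⟩ := Finite.exists_ne_map_eq_of_infinite
      (fun n : ℕ => (⟨f (n + 1), h (n + 1) (by omega)⟩ : {l : List Bool | l.length ≤ N}))
    have he' : f (a + 1) = f (b + 1) := congrArg Subtype.val he
    rcases lt_or_gt_of_ne hab with h | h
    · exact ⟨a + 1, b + 1, by omega, by rw [he']⟩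
    · exact ⟨b + 1, a + 1, by omega, by rw [he']⟩

theorem langL_wqo (s : ℕ → ℕ) (hs : ∀ k, 0 < s k) :
    (∀ f : ℕ → List Bool, (∀ n, f n ∈ langL s) → ∃ m n, m < n ∧ f m <:+: f n) ∧
      (langL s).PartiallyWellOrderedOn (· <:+: ·) := by
  refine ⟨aux_main s hs, ?_⟩
  rw [Set.partiallyWellOrderedOn_iff_exists_lt]
  exact aux_main s hs
end

section
/- For every sequence (s_k) of positive integers, every i ≥ 1, and every binary word w with |w| ≤ s_i · |α_i^{(s)}| + 1: w ∈ L^{(s)} if and only if w is a factor of at least one of the four words u ++ v with u, v ∈ { (α_i^{(s)})^{s_i}, (ᾱ_i^{(s)})^{s_i} }. -/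
theorem wc_wc (x : List Bool) : wordCompl (wordCompl x) = x := by
  simp [wordCompl, Function.comp_def]

theorem wc_append (x y : List Bool) : wordCompl (x ++ y) = wordCompl x ++ wordCompl y := by
  simp [wordCompl]

theorem wc_pow (x : List Bool) (k : ℕ) : wordCompl (wordPow x k) = wordPow (wordCompl x) k := by
  simp [wordCompl, wordPow]

theorem wc_infix {x y : List Bool} (h : x <:+: y) : wordCompl x <:+: wordCompl y := by
  obtain ⟨a, b, rfl⟩ := h
  exact ⟨wordCompl a, wordCompl b, by simp [wordCompl]⟩

theorem wp_succ (x : List Bool) (k : ℕ) : wordPow x (k+1) = x ++ wordPow x k := by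
  simp [wordPow, List.replicate_succ]

theorem wp_succ' (x : List Bool) (k : ℕ) : wordPow x (k+1) = wordPow x k ++ x := by
  simp [wordPow, List.replicate_succ']

theorem alpha_succ (s : ℕ → ℕ) (i : ℕ) (hi : 1 ≤ i) : alphaWord s (i+1) =
    wordPow (alphaWord s i) (s i) ++ wordPow (wordCompl (alphaWord s i)) (s i) := by
  obtain ⟨k, rfl⟩ : ∃ k, i = k + 1 := ⟨i - 1, by omega⟩
  rfl

theorem infix_wp (x : List Bool) (k : ℕ) (hk : 0 < k) : x <:+: wordPow x k := by
  obtain ⟨m, rfl⟩ : ∃ m, k = m + 1 := ⟨k - 1, by omega⟩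
  rw [wp_succ]
  exact (List.prefix_append _ _).isInfix

theorem lang_infix {s : ℕ → ℕ} {x y : List Bool} (h : x <:+: y) (hy : y ∈ langL s) :
    x ∈ langL s := by
  obtain ⟨j, hj, hh⟩ := hy
  exact ⟨j, hj, h.trans hh⟩

theorem lang_compl {s : ℕ → ℕ} (hs : ∀ k, 0 < s k) {x : List Bool} (h : x ∈ langL s) :
    wordCompl x ∈ langL s := by
  obtain ⟨j, hj, hh⟩ := h
  refine ⟨j+1, by omega, (wc_infix hh).trans ?_⟩
  rw [alpha_succ s j hj]
  exact (infix_wp _ _ (hs j)).trans (List.suffix_append _ _).isInfix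

def BlockWord (A B x : List Bool) : Prop :=
  ∃ bs : List (List Bool), (∀ b ∈ bs, b = A ∨ b = B) ∧ x = bs.flatten

theorem BlockWord.append {A B x y : List Bool} (hx : BlockWord A B x) (hy : BlockWord A B y) :
    BlockWord A B (x ++ y) := by
  obtain ⟨a, ha, rfl⟩ := hx
  obtain ⟨b, hb, rfl⟩ := hy
  refine ⟨a ++ b, ?_, by simp⟩
  intro c hc
  rcases List.mem_append.1 hc with h | h
  · exact ha c h
  · exact hb c h

theorem BlockWord.pow {A B x : List Bool} (hx : BlockWord A B x) (k : ℕ) :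
    BlockWord A B (wordPow x k) := by
  induction k with
  | zero => exact ⟨[], by simp, by simp [wordPow]⟩
  | succ k ih => rw [wp_succ]; exact hx.append ih

theorem BlockWord.compl {A x : List Bool} (hx : BlockWord A (wordCompl A) x) :
    BlockWord A (wordCompl A) (wordCompl x) := by
  obtain ⟨a, ha, rfl⟩ := hx
  refine ⟨a.map wordCompl, ?_, ?_⟩
  · intro c hc
    obtain ⟨d, hd, rfl⟩ := List.mem_map.1 hc
    rcases ha d hd with rfl | rfl
    · right; rfl
    · left; exact wc_wc _
  · simp only [wordCompl, List.map_flatten]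
    rfl

theorem blockWord_alpha (s : ℕ → ℕ) (i : ℕ) (hi : 1 ≤ i) (d : ℕ) :
    BlockWord (wordPow (alphaWord s i) (s i)) (wordCompl (wordPow (alphaWord s i) (s i)))
      (alphaWord s (i + 1 + d)) := by
  induction d with
  | zero =>
    refine ⟨[wordPow (alphaWord s i) (s i), wordCompl (wordPow (alphaWord s i) (s i))],
      by simp, ?_⟩
    rw [Nat.add_zero, alpha_succ s i hi, wc_pow]; simp
  | succ d ih =>
    rw [← Nat.add_assoc, alpha_succ s _ (by omega)]
    exact (ih.pow _).append (ih.compl.pow _)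

theorem alpha_infix_add (s : ℕ → ℕ) (hs : ∀ k, 0 < s k) (j : ℕ) (hj : 1 ≤ j) (d : ℕ) :
    alphaWord s j <:+: alphaWord s (j + d) := by
  induction d with
  | zero => exact List.infix_rfl
  | succ d ih =>
    rw [← Nat.add_assoc, alpha_succ s _ (by omega)]
    exact ih.trans ((infix_wp _ _ (hs _)).trans (List.prefix_append _ _).isInfix)

theorem block_key {A B : List Bool} (n : ℕ) (hA : A.length = n) (hB : B.length = n)
    (w : List Bool) (hw : w.length ≤ n + 1) (bs : List (List Bool))
    (hb : ∀ b ∈ bs, b = A ∨ b = B) (h : w <:+: bs.flatten) :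
    ∃ u v : List Bool, (u = A ∨ u = B) ∧ (v = A ∨ v = B) ∧ w <:+: u ++ v := by
  induction bs with
  | nil =>
    have : w = [] := by simpa using h
    subst this
    exact ⟨A, A, Or.inl rfl, Or.inl rfl, List.nil_infix⟩
  | cons b bs ih =>
    have hb0 := hb b (by simp)
    have hb' : ∀ b ∈ bs, b = A ∨ b = B := fun c hc => hb c (by simp [hc])
    rw [List.flatten_cons, List.infix_append_iff] at h
    rcases h with h | h | ⟨l1, l2, rfl, h1, h2⟩
    · exact ⟨b, b, hb0, hb0, h.trans (List.prefix_append _ _).isInfix⟩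
    · exact ih hb' h
    · by_cases hl : l1 = []
      · subst hl
        exact ih hb' (by simpa using h2.isInfix)
      · have hl1 : 0 < l1.length := List.length_pos_iff.2 hl
        obtain ⟨a, rfl⟩ := h1
        cases bs with
        | nil =>
          have : l2 = [] := by simpa using h2
          subst this
          exact ⟨_, _, hb0, hb0, ⟨a, a ++ l1, by simp⟩⟩
        | cons c cs =>
          have hc := hb' c (by simp)
          have hcl : c.length = n := by rcases hc with rfl | rfl <;> assumption
          rw [List.flatten_cons] at h2
          rw [List.length_append] at hw
          obtain ⟨t, rfl⟩ := List.prefix_of_prefix_length_le h2 (List.prefix_append _ _)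
            (by omega)
          exact ⟨_, _, hb0, hc, ⟨a, t, by simp⟩⟩

theorem lang_pairs (s : ℕ → ℕ) (hs : ∀ k, 0 < s k) (i : ℕ) (hi : 1 ≤ i) :
    let A := wordPow (alphaWord s i) (s i)
    A ++ wordCompl A ++ (wordCompl A ++ A) ∈ langL s := by
  intro A
  have h1 : alphaWord s (i+1) = A ++ wordCompl A := by
    rw [alpha_succ s i hi, wc_pow]
  have h2 : wordCompl (alphaWord s (i+1)) = wordCompl A ++ A := by
    rw [h1, wc_append, wc_wc]
  refine ⟨i+2, by omega, ?_⟩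
  rw [alpha_succ s (i+1) (by omega), h1, ← h1, h2, h1]
  obtain ⟨m, hm⟩ : ∃ m, s (i+1) = m + 1 := ⟨s (i+1) - 1, by have := hs (i+1); omega⟩
  rw [hm, wp_succ', wp_succ]
  exact ⟨wordPow (A ++ wordCompl A) m, wordPow (wordCompl A ++ A) m, by simp⟩

theorem short_words_characterization (s : ℕ → ℕ) (hs : ∀ k, 0 < s k) (i : ℕ) (hi : 1 ≤ i)
    (w : List Bool) (hw : w.length ≤ s i * (alphaWord s i).length + 1) :
    w ∈ langL s ↔
      ∃ u v : List Bool,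
        (u = wordPow (alphaWord s i) (s i) ∨
          u = wordPow (wordCompl (alphaWord s i)) (s i)) ∧
        (v = wordPow (alphaWord s i) (s i) ∨
          v = wordPow (wordCompl (alphaWord s i)) (s i)) ∧
        w <:+: (u ++ v) := by
  rw [← wc_pow]
  have hlen : (wordPow (alphaWord s i) (s i)).length = s i * (alphaWord s i).length := by
    simp [wordPow]
  rw [← hlen] at hw
  have hP := lang_pairs s hs i hi
  constructor
  · rintro ⟨j, hj, h⟩
    have key : ∃ d, w <:+: alphaWord s (i + 1 + d) := by
      by_cases hji : j ≤ i + 1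
      · obtain ⟨d, hd⟩ := Nat.exists_eq_add_of_le hji
        exact ⟨0, h.trans (by rw [Nat.add_zero, hd]; exact alpha_infix_add s hs j hj d)⟩
      · obtain ⟨d, rfl⟩ := Nat.exists_eq_add_of_le (by omega : i + 1 ≤ j)
        exact ⟨d, h⟩
    obtain ⟨d, hd⟩ := key
    obtain ⟨bs, hbs, he⟩ := blockWord_alpha s i hi d
    rw [he] at hd
    exact block_key _ rfl (by simp [wordCompl]) w hw bs hbs hd
  · dsimp only at hP
    have hQ := lang_compl hs hP
    simp only [wc_append, wc_wc] at hQ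
    generalize wordPow (alphaWord s i) (s i) = A at *
    rintro ⟨u, v, rfl | rfl, rfl | rfl, h⟩
    · exact lang_infix (h.trans ⟨wordCompl v, wordCompl v, by simp⟩) hQ
    · exact lang_infix (h.trans ⟨[], wordCompl u ++ u, by simp⟩) hP
    · exact lang_infix (h.trans ⟨[], v ++ wordCompl v, by simp⟩) hQ
    · exact lang_infix (h.trans ⟨A, A, by simp⟩) hP
end

section
/- Let (s_k) and (t_k) be sequences of positive integers, and suppose there is an index I ≥ 1 such that s_i = t_i for all 1 ≤ i < I and s_I < t_I. Set M = 2^I · s_1 s_2 ⋯ s_I + 2. Then M ≥ 4; for every n < M the set of words of length n in L^{(s)} equals the set of words of length n in L^{(t)}; and the set of words of length M in L^{(t)} is a proper subset of the set of words of length M in L^{(s)}. -/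
def hh (s : ℕ → ℕ) : ℕ → ℕ
  | 0 => 1
  | (i + 1) => 2 * s (i + 1) * hh s i

def PP (s : ℕ → ℕ) (J m : ℕ) : ℕ := ∑ i ∈ Finset.range J, m / hh s i

theorem PP_succ (s : ℕ → ℕ) (J m : ℕ) : PP s (J + 1) m = PP s J m + m / hh s J := by
  simp [PP, Finset.sum_range_succ]

theorem hh_pos (s : ℕ → ℕ) (hs : ∀ k, 0 < s k) (i : ℕ) : 0 < hh s i := by
  induction i with
  | zero => simp [hh]
  | succ i ih => have := hs (i + 1); simp only [hh]; positivity

theorem hh_eq (s : ℕ → ℕ) (i : ℕ) : hh s i = 2 ^ i * ∏ k ∈ Finset.Icc 1 i, s k := by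
  induction i with
  | zero => simp [hh]
  | succ i ih =>
    rw [hh, ih, Finset.prod_Icc_succ_top (by omega)]; ring

theorem hh_dvd (s : ℕ → ℕ) {i j : ℕ} (h : i ≤ j) : hh s i ∣ hh s j := by
  induction j, h using Nat.le_induction with
  | base => exact dvd_rfl
  | succ j _ ih => rw [hh]; exact Dvd.dvd.mul_left ih _

theorem bodd_flip (s : ℕ → ℕ) (hs : ∀ k, 0 < s k) (j : ℕ) :
    ∀ m, (PP s (j + 1) (m + hh s j)).bodd = !(PP s (j + 1) m).bodd := by
  induction j with
  | zero => intro m; simp [PP, hh]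
  | succ j ih =>
    intro m
    have key : ∀ q m, (PP s (j + 1) (m + 2 * q * hh s j)).bodd = (PP s (j + 1) m).bodd := by
      intro q
      induction q with
      | zero => simp
      | succ q ihq =>
        intro m
        have : m + 2 * (q + 1) * hh s j = m + 2 * q * hh s j + hh s j + hh s j := by ring
        rw [this, ih, ih, ihq]; simp
    have hp := hh_pos s hs (j + 1)
    rw [PP_succ s (j + 1), PP_succ s (j + 1), Nat.add_div_right _ hp, Nat.bodd_add, Nat.bodd_add,
      Nat.bodd_succ]
    have : hh s (j + 1) = 2 * s (j + 1) * hh s j := rfl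
    rw [show PP s (j + 1) (m + hh s (j + 1)) = PP s (j + 1) (m + 2 * s (j + 1) * hh s j) from rfl,
      key]
    simp

theorem bodd_per (s : ℕ → ℕ) (hs : ∀ k, 0 < s k) (j q : ℕ) :
    ∀ m, (PP s (j + 1) (m + 2 * hh s j * q)).bodd = (PP s (j + 1) m).bodd := by
  induction q with
  | zero => simp
  | succ q ihq =>
    intro m
    have : m + 2 * hh s j * (q + 1) = m + 2 * hh s j * q + hh s j + hh s j := by ring
    rw [this, bodd_flip s hs, bodd_flip s hs, ihq]; simp

/-- if x + b and y + b are both multiples of `2 h_j`, equal base letters -/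
theorem bodd_congr (s : ℕ → ℕ) (hs : ∀ k, 0 < s k) (j x y b k : ℕ)
    (hx : 2 * hh s j ∣ x + b) (hy : 2 * hh s j ∣ y + b) :
    (PP s (j + 1) (x + k)).bodd = (PP s (j + 1) (y + k)).bodd := by
  wlog h : x ≤ y generalizing x y
  · exact (this y x hy hx (by omega)).symm
  obtain ⟨q, hq⟩ := (Nat.dvd_sub hy hx)
  have : y + k = x + k + 2 * hh s j * q := by omega
  rw [this, bodd_per s hs]

theorem bodd_congr_half (s : ℕ → ℕ) (hs : ∀ k, 0 < s k) (j x y b : ℕ)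
    (hx : hh s j ∣ x + b) (hy : hh s j ∣ y + b) :
    ∃ c, ∀ k, (PP s (j + 1) (x + k)).bodd = xor (PP s (j + 1) (y + k)).bodd c := by
  have hit : ∀ q m, (PP s (j + 1) (m + hh s j * q)).bodd = xor (PP s (j + 1) m).bodd q.bodd := by
    intro q
    induction q with
    | zero => simp
    | succ q ihq =>
      intro m
      have : m + hh s j * (q + 1) = m + hh s j * q + hh s j := by ring
      rw [this, bodd_flip s hs, ihq]; simp
  rcases le_total x y with h | h
  · obtain ⟨q, hq⟩ := (Nat.dvd_sub hy hx)
    refine ⟨q.bodd, fun k => ?_⟩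
    have : y + k = x + k + hh s j * q := by omega
    rw [this, hit]; simp
  · obtain ⟨q, hq⟩ := (Nat.dvd_sub hx hy)
    refine ⟨q.bodd, fun k => ?_⟩
    have : x + k = y + k + hh s j * q := by omega
    rw [this, hit]

theorem wordPow_map (f : ℕ → Bool) (l : ℕ) (hf : ∀ m, f (m + l) = f m) (k : ℕ) :
    wordPow ((List.range l).map f) k = (List.range (k * l)).map f := by
  induction k with
  | zero => simp [wordPow]
  | succ k ih =>
    have : wordPow ((List.range l).map f) (k + 1)
        = (List.range l).map f ++ wordPow ((List.range l).map f) k := by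
      simp [wordPow, List.replicate_succ]
    rw [this, ih, show (k + 1) * l = l + k * l by ring, List.range_add]
    simp only [List.map_append, List.map_map]
    congr 1
    apply List.map_congr_left
    intro m _
    simp [add_comm l m, hf]

theorem alpha_eq (s : ℕ → ℕ) (hs : ∀ k, 0 < s k) (i : ℕ) :
    alphaWord s (i + 1) = (List.range (2 * hh s i)).map (fun m => (PP s (i + 1) m).bodd) := by
  induction i with
  | zero => simp [alphaWord, hh, PP, List.range_succ]
  | succ i ih =>
    rw [alphaWord, ih]
    have hper : ∀ m, (PP s (i + 1) (m + 2 * hh s i)).bodd = (PP s (i + 1) m).bodd := by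
      intro m; simpa using bodd_per s hs i 1 m
    have hc : wordCompl ((List.range (2 * hh s i)).map (fun m => (PP s (i + 1) m).bodd))
        = (List.range (2 * hh s i)).map (fun m => !(PP s (i + 1) m).bodd) := by
      simp [wordCompl]
    rw [hc, wordPow_map _ _ hper, wordPow_map _ _ (fun m => by rw [hper m])]
    have h1 : s (i + 1) * (2 * hh s i) = hh s (i + 1) := by rw [hh]; ring
    rw [h1, two_mul (hh s (i + 1)), List.range_add, List.map_append, List.map_map]
    have hp := hh_pos s hs (i + 1)
    congr 1
    · apply List.map_congr_left
      intro m hm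
      rw [List.mem_range] at hm
      rw [PP_succ s (i + 1), Nat.div_eq_of_lt hm]; rfl
    · apply List.map_congr_left
      intro m hm
      rw [List.mem_range] at hm
      simp only [Function.comp]
      rw [PP_succ s (i + 1), Nat.add_div_left _ hp, Nat.div_eq_of_lt hm, Nat.bodd_add]
      have h2 : hh s (i + 1) + m = m + 2 * hh s i * s (i + 1) := by rw [← h1]; ring
      rw [h2, bodd_per s hs]; simp

theorem mem_win (s : ℕ → ℕ) (hs : ∀ k, 0 < s k) (J a n : ℕ) (h : a + n ≤ 2 * hh s J) :
    (List.range n).map (fun k => (PP s (J + 1) (a + k)).bodd) ∈ langL s := by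
  refine ⟨J + 1, by omega, ?_⟩
  rw [alpha_eq s hs]
  obtain ⟨r, hr⟩ := Nat.exists_eq_add_of_le h
  rw [hr, List.range_add, List.range_add]
  simp only [List.map_append, List.map_map]
  exact ⟨_, _, rfl⟩

theorem mem_win' (s : ℕ → ℕ) (hs : ∀ k, 0 < s k) (J a n : ℕ) (h : a + n ≤ 2 * hh s J) (c : Bool) :
    (List.range n).map (fun k => xor (PP s (J + 1) (a + k)).bodd c) ∈ langL s := by
  cases c with
  | false => simpa using mem_win s hs J a n h
  | true =>
    have hd : hh s (J + 1) = 2 * hh s J * s (J + 1) := by rw [hh]; ring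
    have h1 : 2 * hh s J ≤ hh s (J + 1) := by
      rw [hd]; exact Nat.le_mul_of_pos_right _ (hs _)
    have := mem_win s hs (J + 1) (hh s (J + 1) + a) n (by omega)
    convert this using 1
    apply List.map_congr_left
    intro k hk
    rw [List.mem_range] at hk
    have hp := hh_pos s hs (J + 1)
    rw [PP_succ s (J + 1), add_assoc, Nat.add_div_left _ hp, Nat.div_eq_of_lt (by omega),
      Nat.bodd_add]
    rw [show hh s (J + 1) + (a + k) = (a + k) + 2 * hh s J * s (J + 1) by omega, bodd_per s hs]
    simp

theorem alpha_succ_s10 (s : ℕ → ℕ) (hs : ∀ k, 0 < s k) (i : ℕ) (hi : 1 ≤ i) :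
    alphaWord s i <:+: alphaWord s (i + 1) := by
  obtain ⟨i, rfl⟩ := Nat.exists_eq_add_of_le' hi
  rw [alphaWord]
  obtain ⟨q, hq⟩ := Nat.exists_eq_add_of_lt (hs (i + 1))
  rw [hq]
  simp only [wordPow, List.replicate_succ, zero_add, List.flatten_cons]
  exact ⟨[], _, by simp only [List.nil_append, List.append_assoc]; rfl⟩

theorem alpha_mono (s : ℕ → ℕ) (hs : ∀ k, 0 < s k) (i j : ℕ) (hi : 1 ≤ i) (h : i ≤ j) :
    alphaWord s i <:+: alphaWord s j := by
  induction j, h using Nat.le_induction with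
  | base => exact List.infix_rfl
  | succ j hj ih => exact ih.trans (alpha_succ_s10 s hs j (by omega))

theorem langL_win (s : ℕ → ℕ) (hs : ∀ k, 0 < s k) (j : ℕ) (w : List Bool) (hw : w ∈ langL s) :
    ∃ J a, j ≤ J ∧ w = (List.range w.length).map (fun k => (PP s (J + 1) (a + k)).bodd) := by
  obtain ⟨i, hi, h⟩ := hw
  have h2 := h.trans (alpha_mono s hs i (i + j + 1) hi (by omega))
  rw [alpha_eq s hs] at h2
  obtain ⟨u, v, huv⟩ := h2
  refine ⟨i + j, u.length, by omega, ?_⟩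
  apply List.ext_getElem
  · simp
  intro k h1 h2
  have h3 : (u ++ w ++ v)[u.length + k]? = some w[k] := by
    rw [List.append_assoc, List.getElem?_append_right (by omega)]
    rw [Nat.add_sub_cancel_left, List.getElem?_append_left h1, List.getElem?_eq_getElem h1]
  rw [huv] at h3
  rw [List.getElem?_eq_some_iff] at h3
  obtain ⟨_, h4⟩ := h3
  simp at h4
  simp [h4]

def TW (s : ℕ → ℕ) (j r b : ℕ) (c : Bool) (n : ℕ) : List Bool :=
  (List.range n).map (fun k => xor (xor (PP s (j + 1) (r + k)).bodd c) (decide (b ≤ k)))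

theorem higher_const (s : ℕ → ℕ) (hs : ∀ k, 0 < s k) (j d x y : ℕ)
    (h : x / hh s (j + 1) = y / hh s (j + 1)) :
    ∃ u, PP s (j + 1 + d) x = PP s (j + 1) x + u ∧ PP s (j + 1 + d) y = PP s (j + 1) y + u := by
  induction d with
  | zero => exact ⟨0, by simp⟩
  | succ d ih =>
    obtain ⟨u, h1, h2⟩ := ih
    refine ⟨u + x / hh s (j + 1 + d), ?_, ?_⟩
    · rw [← add_assoc, PP_succ, h1]; ring
    · rw [← add_assoc, PP_succ, h2]
      obtain ⟨q, hq⟩ := hh_dvd s (show j + 1 ≤ j + 1 + d by omega)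
      have : x / hh s (j + 1 + d) = y / hh s (j + 1 + d) := by
        rw [hq, ← Nat.div_div_eq_div_mul, ← Nat.div_div_eq_div_mul, h]
      rw [this]; ring

theorem two_dvd (s : ℕ → ℕ) (j : ℕ) : 2 * hh s j ∣ hh s (j + 1) :=
  ⟨s (j + 1), by rw [hh]; ring⟩

theorem L_sub_T (s : ℕ → ℕ) (hs : ∀ k, 0 < s k) (j n : ℕ) (hn : n ≤ hh s (j + 1) + 1)
    (w : List Bool) (hw : w ∈ langL s) (hl : w.length = n) :
    ∃ r b c, 2 * hh s j ∣ r + b ∧ 1 ≤ b ∧ w = TW s j r b c n := by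
  obtain ⟨J, a, hJ, h⟩ := langL_win s hs j w hw
  rw [hl] at h
  obtain ⟨d, rfl⟩ := Nat.exists_eq_add_of_le hJ
  have hp := hh_pos s hs (j + 1)
  have hpj := hh_pos s hs j
  have hdv := two_dvd s j
  set H := hh s (j + 1) with hH
  obtain ⟨b, hb, hb1, hbH⟩ : ∃ b, H * (a / H + 1) = a + b ∧ 1 ≤ b ∧ b ≤ H := by
    refine ⟨H - a % H, ?_, ?_, ?_⟩
    · have := Nat.div_add_mod a H
      have := Nat.mod_lt a hp
      rw [mul_add]; omega
    · have := Nat.mod_lt a hp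
      omega
    · omega
  have hD : 2 * hh s j ∣ a + b := by rw [← hb]; exact Dvd.dvd.mul_right hdv _
  have hlow : ∀ k, k < b → (a + k) / H = a / H := by
    intro k hk
    apply Nat.div_eq_of_lt_le
    · have := Nat.div_mul_le_self a H; omega
    · rw [mul_comm, hb]; omega
  have hhigh : ∀ k, b ≤ k → k < n → (a + k) / H = a / H + 1 := by
    intro k hk hk2
    apply Nat.div_eq_of_lt_le
    · rw [mul_comm, hb]; omega
    · rw [mul_comm, mul_add, hb]; omega
  have hlow' : ∃ c, ∀ k, k < b →
      (PP s (j + d + 1) (a + k)).bodd = xor (PP s (j + 1) (a + k)).bodd c := by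
    obtain ⟨u, hu, _⟩ := higher_const s hs j d a a rfl
    refine ⟨u.bodd, fun k hk => ?_⟩
    obtain ⟨u', h1, h2⟩ := higher_const s hs j d (a + k) a (hlow k hk)
    rw [show j + d + 1 = j + 1 + d by ring, h1, show u' = u by omega, Nat.bodd_add]
  have hhigh' : ∃ c, ∀ k, b ≤ k → k < n →
      (PP s (j + d + 1) (a + k)).bodd = xor (PP s (j + 1) (a + k)).bodd c := by
    obtain ⟨u, hu, _⟩ := higher_const s hs j d (a + b) (a + b) rfl
    refine ⟨u.bodd, fun k hk hk2 => ?_⟩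
    obtain ⟨u', h1, h2⟩ := higher_const s hs j d (a + k) (a + b)
      (by rw [← hH, hhigh k hk hk2, hhigh b le_rfl (by omega)])
    rw [show j + d + 1 = j + 1 + d by ring, h1, show u' = u by omega, Nat.bodd_add]
  obtain ⟨c, hc⟩ := hlow'
  obtain ⟨c', hc'⟩ := hhigh'
  by_cases hcc : c = c'
  · refine ⟨a, b + 2 * hh s j * n, c, ?_, by omega, ?_⟩
    · rw [← add_assoc]; exact dvd_add hD (dvd_mul_right _ _)
    · rw [h, TW]
      apply List.map_congr_left
      intro k hk
      rw [List.mem_range] at hk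
      have h3 : n ≤ 2 * hh s j * n := Nat.le_mul_of_pos_left _ (by omega)
      have : ¬ (b + 2 * hh s j * n ≤ k) := by omega
      simp only [this, decide_false, Bool.xor_false]
      by_cases hkb : k < b
      · exact hc k hkb
      · rw [hcc]; exact hc' k (by omega) hk
  · refine ⟨a, b, c, hD, hb1, ?_⟩
    rw [h, TW]
    apply List.map_congr_left
    intro k hk
    rw [List.mem_range] at hk
    by_cases hkb : k < b
    · rw [hc k hkb]; simp [show ¬ (b ≤ k) by omega]
    · have : b ≤ k := by omega
      rw [hc' k this hk]
      have : c' = !c := by revert hcc; cases c <;> cases c' <;> simp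
      simp [*]

theorem T_sub_L_top (s : ℕ → ℕ) (hs : ∀ k, 0 < s k) (j r b : ℕ) (c : Bool)
    (hD : 2 * hh s j ∣ r + b) (hb : 1 ≤ b) :
    TW s j r b c (hh s (j + 1) + 2) ∈ langL s := by
  have hp := hh_pos s hs (j + 1)
  have hpj := hh_pos s hs j
  have hdv := two_dvd s j
  have h2dv := two_dvd s (j + 1)
  have hle := Nat.le_of_dvd hp hdv
  have hp2 := hh_pos s hs (j + 2)
  have hle2 := Nat.le_of_dvd hp2 h2dv
  have hdv2 : 2 * hh s j ∣ hh s (j + 2) := hdv.trans (hh_dvd s (by omega))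
  have hPP : ∀ x, PP s (j + 3) x = PP s (j + 1) x + (x / hh s (j + 1) + x / hh s (j + 2)) := by
    intro x; rw [PP_succ s (j + 2), PP_succ s (j + 1)]; ring
  obtain ⟨m, hm⟩ := h2dv
  set H := hh s (j + 1) with hH
  set H2 := hh s (j + 2) with hH2
  have hm1 : 1 ≤ m := by
    rcases m with _ | m
    · omega
    · omega
  obtain ⟨m, rfl⟩ := Nat.exists_eq_add_of_le' hm1
  have q0 : ∀ q x, q * H ≤ x → x < (q + 1) * H → x / H = q := fun q x h1 h2 =>
    Nat.div_eq_of_lt_le h1 h2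
  have e1 : H2 = 2 * (m * H) + 2 * H := by rw [hm]; ring
  -- quotients around H2
  have d0 : ∀ x, H2 ≤ x + 2 * H → x + H < H2 → x / H = 2 * m := fun x h1 h2 => by
    apply q0 <;> ring_nf at * <;> omega
  have d1 : ∀ x, H2 ≤ x + H → x < H2 → x / H = 2 * m + 1 := fun x h1 h2 => by
    apply q0 <;> ring_nf at * <;> omega
  have d2 : ∀ x, H2 ≤ x → x < H2 + H → x / H = 2 * (m + 1) := fun x h1 h2 => by
    apply q0 <;> ring_nf at * <;> omega
  have d3 : ∀ x, H2 + H ≤ x → x < H2 + 2 * H → x / H = 2 * (m + 1) + 1 := fun x h1 h2 => by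
    apply q0 <;> ring_nf at * <;> omega
  have f0 : ∀ x, x < H2 → x / H2 = 0 := fun x h => Nat.div_eq_of_lt h
  have f1 : ∀ x, H2 ≤ x → x < 2 * H2 → x / H2 = 1 := fun x h1 h2 =>
    Nat.div_eq_of_lt_le (by omega) (by omega)
  by_cases c1 : b = 1
  · subst c1
    have := mem_win' s hs (j + 2) (H2 - H - 1) (H + 2) (by omega) c
    convert this using 1
    apply List.map_congr_left
    intro k hk
    rw [List.mem_range] at hk
    rw [hPP, Nat.bodd_add, bodd_congr s hs j r (H2 - H - 1) 1 k hD
      (by rw [show H2 - H - 1 + 1 = H2 - H by omega]; exact Nat.dvd_sub hdv2 hdv)]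
    rcases (show k = 0 ∨ (1 ≤ k ∧ k ≤ H) ∨ k = H + 1 by omega) with h | h | h
    · rw [d0 _ (by omega) (by omega), f0 _ (by omega)]; simp [h]
    · rw [d1 _ (by omega) (by omega), f0 _ (by omega)]
      have := h.1
      simp [this]
    · rw [d2 _ (by omega) (by omega), f1 _ (by omega) (by omega)]
      simp [h]
  by_cases c2 : b ≤ H
  · have := mem_win' s hs (j + 1) (H - b) (H + 2) (by omega) c
    convert this using 1
    apply List.map_congr_left
    intro k hk
    rw [List.mem_range] at hk
    rw [PP_succ s (j + 1), Nat.bodd_add, bodd_congr s hs j r (H - b) b k hD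
      (by rw [show H - b + b = H by omega]; exact hdv)]
    by_cases h : b ≤ k
    · rw [q0 1 _ (by omega) (by omega)]; simp [h]
    · rw [q0 0 _ (by omega) (by omega)]; simp [h]
  by_cases c3 : b = H + 1
  · have := mem_win' s hs (j + 2) (H2 - 1) (H + 2) (by omega) (!c)
    convert this using 1
    apply List.map_congr_left
    intro k hk
    rw [List.mem_range] at hk
    rw [hPP, Nat.bodd_add, bodd_congr s hs j r (H2 - 1) b k hD
      (by rw [show H2 - 1 + b = H2 + H by omega]; exact dvd_add hdv2 hdv)]
    rcases (show k = 0 ∨ (1 ≤ k ∧ k ≤ H) ∨ k = H + 1 by omega) with h | h | h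
    · rw [d1 _ (by omega) (by omega), f0 _ (by omega)]
      have : ¬ (b ≤ k) := by omega
      simp [this]
    · rw [d2 _ (by omega) (by omega), f1 _ (by omega) (by omega)]
      have : ¬ (b ≤ k) := by omega
      simp [this]
    · rw [d3 _ (by omega) (by omega), f1 _ (by omega) (by omega)]
      simp [h, c3]
  · obtain ⟨b', hb1, hb2, hb3⟩ : ∃ b', 2 ≤ b' ∧ b' ≤ hh s j + 1 ∧ hh s j ∣ r + b' := by
      have h1 := Nat.mod_lt (r + 1) hpj
      refine ⟨hh s j + 1 - (r + 1) % hh s j, by omega, by omega,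
        ⟨1 + (r + 1) / hh s j, ?_⟩⟩
      have := Nat.div_add_mod (r + 1) (hh s j)
      rw [mul_add]; omega
    obtain ⟨c'', hc''⟩ := bodd_congr_half s hs j r (H2 - b') b' hb3
      (by rw [show H2 - b' + b' = H2 by omega]; exact hh_dvd s (by omega))
    have := mem_win' s hs (j + 2) (H2 - b') (H + 2) (by omega) (!(xor c'' c))
    convert this using 1
    apply List.map_congr_left
    intro k hk
    rw [List.mem_range] at hk
    have hbk : ¬ (b ≤ k) := by omega
    rw [hPP, Nat.bodd_add, hc'']
    by_cases h : b' ≤ k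
    · rw [d2 _ (by omega) (by omega), f1 _ (by omega) (by omega)]
      simp [hbk]
    · rw [d1 _ (by omega) (by omega), f0 _ (by omega)]
      simp [hbk]

theorem T_sub_L (s : ℕ → ℕ) (hs : ∀ k, 0 < s k) (j r b : ℕ) (c : Bool) (n : ℕ)
    (hD : 2 * hh s j ∣ r + b) (hb : 1 ≤ b) (hn : n ≤ hh s (j + 1) + 2) :
    TW s j r b c n ∈ langL s := by
  obtain ⟨i, hi, h⟩ := T_sub_L_top s hs j r b c hD hb
  refine ⟨i, hi, List.IsInfix.trans ?_ h⟩
  obtain ⟨d, hd⟩ := Nat.exists_eq_add_of_le hn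
  rw [hd, TW, TW, List.range_add, List.map_append]
  exact (List.prefix_append _ _).isInfix

theorem L_iff_T (s : ℕ → ℕ) (hs : ∀ k, 0 < s k) (j n : ℕ) (hn : n ≤ hh s (j + 1) + 1)
    (w : List Bool) : (w ∈ langL s ∧ w.length = n) ↔
    ∃ r b c, 2 * hh s j ∣ r + b ∧ 1 ≤ b ∧ w = TW s j r b c n := by
  constructor
  · rintro ⟨h1, h2⟩; exact L_sub_T s hs j n hn w h1 h2
  · rintro ⟨r, b, c, h1, h2, rfl⟩
    exact ⟨T_sub_L s hs j r b c n h1 h2 (by omega), by simp [TW]⟩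

theorem exists_new (s : ℕ → ℕ) (hs : ∀ k, 0 < s k) (j : ℕ) :
    ∃ w ∈ langL s, w.length = hh s (j + 1) + 2 ∧
      ∀ r b c, w ≠ TW s j r b c (hh s (j + 1) + 2) := by
  have hp := hh_pos s hs (j + 1)
  have hpj := hh_pos s hs j
  have hdv := two_dvd s j
  have hle := Nat.le_of_dvd hp hdv
  have hp2 := hh_pos s hs (j + 2)
  have hle2 := Nat.le_of_dvd hp2 (two_dvd s (j + 1))
  have hp3 := hh_pos s hs (j + 3)
  have hle3 := Nat.le_of_dvd hp3 (two_dvd s (j + 2))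
  refine ⟨_, mem_win s hs (j + 3) (hh s (j + 3) - 1) (hh s (j + 1) + 2) (by omega), by simp, ?_⟩
  intro r b c h
  have hk : ∀ k, k < hh s (j + 1) + 2 →
      (PP s (j + 4) (hh s (j + 3) - 1 + k)).bodd =
        xor (xor (PP s (j + 1) (r + k)).bodd c) (decide (b ≤ k)) := by
    rw [TW, List.map_inj_left] at h
    intro k hk
    exact h k (by simpa using hk)
  -- parity of the quotients
  have hPP : ∀ x, PP s (j + 4) x = PP s (j + 1) x +
      (x / hh s (j + 1) + x / hh s (j + 2) + x / hh s (j + 3)) := by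
    intro x; rw [PP_succ s (j + 3), PP_succ s (j + 2), PP_succ s (j + 1)]; ring
  obtain ⟨m, hm⟩ := two_dvd s (j + 1)
  obtain ⟨l, hl⟩ := two_dvd s (j + 2)
  simp only [add_assoc, Nat.reduceAdd] at hm hl
  set g := hh s j with hg
  set H := hh s (j + 1) with hH
  set H2 := hh s (j + 2) with hH2
  set H3 := hh s (j + 3) with hH3
  have hm1 : 1 ≤ m := by
    rcases m with _ | m <;> omega
  have hl1 : 1 ≤ l := by
    rcases l with _ | m <;> omega
  have e3 : H3 = H * (4 * (m * l)) := by rw [hl, hm]; ring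
  have hml : 1 ≤ m * l := Nat.mul_pos hm1 hl1
  obtain ⟨v, hv⟩ := Nat.exists_eq_add_of_le' hml
  rw [hv] at e3
  obtain ⟨l, rfl⟩ := Nat.exists_eq_add_of_le' hl1
  have e3' : H3 = 4 * (v * H) + 4 * H := by rw [e3]; ring
  have e2' : H3 = 2 * (l * H2) + 2 * H2 := by rw [hl]; ring
  have q1 : ∀ q x, q * H ≤ x → x < (q + 1) * H → x / H = q := fun q x h1 h2 =>
    Nat.div_eq_of_lt_le h1 h2
  have q2 : ∀ q x, q * H2 ≤ x → x < (q + 1) * H2 → x / H2 = q := fun q x h1 h2 =>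
    Nat.div_eq_of_lt_le h1 h2
  have q3 : ∀ q x, q * H3 ≤ x → x < (q + 1) * H3 → x / H3 = q := fun q x h1 h2 =>
    Nat.div_eq_of_lt_le h1 h2
  have t0 : (PP s (j + 4) (H3 - 1 + 0)).bodd = (PP s (j + 1) (H3 - 1 + 0)).bodd := by
    rw [hPP, q1 (2 * (2 * v + 1) + 1), q2 (2 * l + 1), q3 0]
    · simp
    all_goals ring_nf at * <;> omega
  have t1 : ∀ k, 1 ≤ k → k ≤ H →
      (PP s (j + 4) (H3 - 1 + k)).bodd = !(PP s (j + 1) (H3 - 1 + k)).bodd := by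
    intro k hk1 hk2
    rw [hPP, q1 (2 * (2 * v + 2)), q2 (2 * (l + 1)), q3 1]
    · simp
    all_goals ring_nf at * <;> omega
  have t2 : (PP s (j + 4) (H3 - 1 + (H + 1))).bodd = (PP s (j + 1) (H3 - 1 + (H + 1))).bodd := by
    rw [hPP, q1 (2 * (2 * v + 2) + 1), q2 (2 * (l + 1)), q3 1]
    · simp
    all_goals ring_nf at * <;> omega
  have a0 := hk 0 (by omega)
  have a1 := hk g (by omega)
  have a2 := hk (H + 1 - g) (by omega)
  have a3 := hk (H + 1) (by omega)
  rw [t0] at a0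
  rw [t1 _ (by omega) (by omega)] at a1
  rw [t1 _ (by omega) (by omega)] at a2
  rw [t2] at a3
  have fl := bodd_flip s hs j
  have b1 := fl (H3 - 1 + 0)
  have b2 := fl (r + 0)
  have b3 := fl (H3 - 1 + (H + 1 - g))
  have b4 := fl (r + (H + 1 - g))
  rw [← hg, show H3 - 1 + 0 + g = H3 - 1 + g by omega] at b1
  rw [← hg, show r + 0 + g = r + g by omega] at b2
  rw [← hg, show H3 - 1 + (H + 1 - g) + g = H3 - 1 + (H + 1) by omega] at b3
  rw [← hg, show r + (H + 1 - g) + g = r + (H + 1) by omega] at b4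
  rw [b1, b2] at a1
  rw [b3, b4] at a3
  rw [a0] at a1
  have z1 : decide (b ≤ 0) ≠ decide (b ≤ g) := by
    intro he; rw [he] at a1
    revert a1
    cases (PP s (j + 1) (r + 0)).bodd <;> cases c <;> cases decide (b ≤ g) <;> simp
  have z2 : decide (b ≤ H + 1 - g) ≠ decide (b ≤ H + 1) := by
    intro he; rw [he] at a2
    revert a2 a3
    cases (PP s (j + 1) (r + (H + 1 - g))).bodd <;> cases c <;> cases decide (b ≤ H + 1) <;>
      cases (PP s (j + 1) (H3 - 1 + (H + 1 - g))).bodd <;> simp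
  have y1 : b ≤ g := by
    by_contra hcon
    apply z1
    have : ¬ b ≤ 0 := by omega
    simp only [hcon, this]
  apply z2
  have x1 : b ≤ H + 1 - g := by omega
  have x2 : b ≤ H + 1 := by omega
  simp only [x1, x2]

theorem hh_congr (s t : ℕ → ℕ) (j : ℕ) (h : ∀ i, 1 ≤ i → i < j + 1 → s i = t i) :
    ∀ i, i ≤ j → hh s i = hh t i := by
  intro i
  induction i with
  | zero => intro _; rfl
  | succ i ih => intro hi; rw [hh, hh, ih (by omega), h (i + 1) (by omega) (by omega)]

theorem TW_congr (s t : ℕ → ℕ) (j : ℕ) (h : ∀ i, 1 ≤ i → i < j + 1 → s i = t i) :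
    TW s j = TW t j := by
  have : PP s (j + 1) = PP t (j + 1) := by
    funext m
    unfold PP
    apply Finset.sum_congr rfl
    intro i hi
    rw [Finset.mem_range] at hi
    rw [hh_congr s t j h i (by omega)]
  funext r b c n
  simp only [TW, this]

theorem langL_distinct_enumerations (s t : ℕ → ℕ) (hs : ∀ k, 0 < s k) (ht : ∀ k, 0 < t k)
    (I : ℕ) (hI : 1 ≤ I) (hagree : ∀ i, 1 ≤ i → i < I → s i = t i) (hlt : s I < t I)
    (M : ℕ) (hM : M = 2 ^ I * (∏ k ∈ Finset.Icc 1 I, s k) + 2) :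
    4 ≤ M ∧
      (∀ n, n < M → {w ∈ langL s | w.length = n} = {w ∈ langL t | w.length = n}) ∧
      {w ∈ langL t | w.length = M} ⊂ {w ∈ langL s | w.length = M} := by
  obtain ⟨j, rfl⟩ := Nat.exists_eq_add_of_le' hI
  rw [← hh_eq] at hM
  have hg := hh_congr s t j hagree j le_rfl
  have hT := TW_congr s t j hagree
  have hpj := hh_pos s hs j
  have hle := Nat.le_of_dvd (hh_pos s hs (j + 1)) (two_dvd s j)
  have hHt : hh s (j + 1) + 2 ≤ hh t (j + 1) + 1 := by
    rw [hh, hh, ← hg]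
    have : 2 * (s (j + 1) + 1) * hh s j ≤ 2 * t (j + 1) * hh s j := by gcongr; omega
    have h2 : 2 * (s (j + 1) + 1) * hh s j = 2 * s (j + 1) * hh s j + 2 * hh s j := by ring
    omega
  refine ⟨by omega, ?_, ?_⟩
  · intro n hn
    ext w
    simp only [Set.mem_setOf_eq]
    rw [L_iff_T s hs j n (by omega), L_iff_T t ht j n (by omega), hT, hg]
  · rw [Set.ssubset_iff_of_subset]
    · obtain ⟨w, h1, h2, h3⟩ := exists_new s hs j
      refine ⟨w, ⟨h1, by omega⟩, ?_⟩
      intro h4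
      have h4' := (L_iff_T t ht j M (by omega) w).1 h4
      obtain ⟨r, b, c, _, _, h5⟩ := h4'
      apply h3 r b c
      rw [hT, h5, hM]
    · intro w hw
      have h4' := (L_iff_T t ht j M (by omega) w).1 hw
      obtain ⟨r, b, c, h6, h7, h5⟩ := h4'
      refine ⟨?_, hw.2⟩
      rw [h5, ← hT]
      exact T_sub_L s hs j r b c M (by rw [hg]; exact h6) h7 (by omega)
end

section
/- There exists a set 𝔏 of sets of binary words (𝔏 : Set (Set (List Bool))) such that: 𝔏 is uncountable (¬ 𝔏.Countable); every L ∈ 𝔏 is factor-closed (whenever w ∈ L and u is a factor of w, also u ∈ L); every L ∈ 𝔏 is well-quasi-ordered under the factor order (for every f : ℕ → List Bool taking values in L there are m < n with f m a factor of f n); and any two distinct members L, L' ∈ 𝔏 have distinct counting functions, i.e. there exists n with Set.ncard {w ∈ L : |w| = n} ≠ Set.ncard {w ∈ L' : |w| = n}. -/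
structure FSt where
  W : Set (List Bool)
  n : ℕ
  pos : 1 ≤ n
  len : ∀ x ∈ W, x.length = n
  two : ∃ A ∈ W, ∃ B ∈ W, A ≠ B

def Fac (W : Set (List Bool)) : Set (List Bool) :=
  {w | ∃ bs : List (List Bool), (∀ b ∈ bs, b ∈ W) ∧ w <:+: bs.flatten}

def Refines (S T : FSt) : Prop :=
  (∀ x ∈ T.W, ∃ bs : List (List Bool), (∀ b ∈ bs, b ∈ S.W) ∧ x = bs.flatten) ∧
  (∀ x ∈ T.W, ∀ a ∈ S.W, ∀ b ∈ S.W, a ++ b <:+: x)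

theorem short_aux (W : Set (List Bool)) (n : ℕ) (hlen : ∀ x ∈ W, x.length = n)
    (hne : W.Nonempty) (w : List Bool) (hw : w.length ≤ n) (t : List Bool) :
    ∀ (bs : List (List Bool)) (s : List Bool), (∀ b ∈ bs, b ∈ W) → s ++ w ++ t = bs.flatten →
      ∃ x ∈ W, ∃ y ∈ W, w <:+: x ++ y := by
  intro bs
  induction bs with
  | nil =>
    intro s _ h
    obtain ⟨x, hx⟩ := hne
    simp at h
    exact ⟨x, hx, x, hx, by simp [h.2.1]⟩
  | cons b bs ih =>
    intro s hb h
    have hbW : b ∈ W := hb b (by simp)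
    have hbl := hlen b hbW
    by_cases hs : n ≤ s.length
    · apply ih (s.drop n) (fun c hc => hb c (by simp [hc]))
      have := congrArg (List.drop n) h
      rw [List.flatten_cons, List.drop_append_of_le_length (by simp; omega),
        List.drop_append_of_le_length (by omega), List.drop_left' hbl] at this
      exact this
    · cases bs with
      | nil =>
        refine ⟨b, hbW, b, hbW, ?_⟩
        apply List.infix_append_of_infix_left
        simp at h
        exact ⟨s, t, by simpa using h⟩
      | cons c bs =>
        have hcW : c ∈ W := hb c (by simp)
        have hcl := hlen c hcW
        refine ⟨b, hbW, c, hcW, ?_⟩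
        have h1 : s ++ w <+: (b :: c :: bs).flatten := ⟨t, h⟩
        have h2 : b ++ c <+: (b :: c :: bs).flatten := ⟨bs.flatten, by simp⟩
        have h3 := List.prefix_of_prefix_length_le h1 h2 (by simp; omega)
        exact (List.infix_append_right).trans h3.isInfix

theorem long_aux (W : Set (List Bool)) (n : ℕ) (hlen : ∀ x ∈ W, x.length = n) (hn : 1 ≤ n)
    (w : List Bool) (hw : 2 * n ≤ w.length) (t : List Bool) :
    ∀ (bs : List (List Bool)) (s : List Bool), (∀ b ∈ bs, b ∈ W) → s ++ w ++ t = bs.flatten →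
      ∃ x ∈ W, x <:+: w := by
  intro bs
  induction bs with
  | nil =>
    intro s _ h
    simp at h
    simp [h.2.1] at hw
    omega
  | cons b bs ih =>
    intro s hb h
    have hbW : b ∈ W := hb b (by simp)
    have hbl := hlen b hbW
    by_cases hs : n ≤ s.length
    · apply ih (s.drop n) (fun c hc => hb c (by simp [hc]))
      have := congrArg (List.drop n) h
      rw [List.flatten_cons, List.drop_append_of_le_length (by simp; omega),
        List.drop_append_of_le_length (by omega), List.drop_left' hbl] at this
      exact this
    · cases bs with
      | nil =>
        have := congrArg List.length h
        simp at this
        omega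
      | cons c bs =>
        have hcW : c ∈ W := hb c (by simp)
        have hcl := hlen c hcW
        refine ⟨c, hcW, ?_⟩
        have h1 : s ++ w <+: (b :: c :: bs).flatten := ⟨t, h⟩
        have h2 : b ++ c <+: (b :: c :: bs).flatten := ⟨bs.flatten, by simp⟩
        have h3 := List.prefix_of_prefix_length_le h2 h1 (by simp; omega)
        obtain ⟨r, hr⟩ := h3
        have := congrArg (List.drop s.length) hr
        rw [List.drop_left, List.append_assoc, List.drop_append_of_le_length (by omega)] at this
        exact ⟨_, _, by rw [List.append_assoc]; exact this⟩

theorem FSt.ne (S : FSt) : S.W.Nonempty := by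
  obtain ⟨A, hA, _⟩ := S.two
  exact ⟨A, hA⟩

theorem FSt.short (S : FSt) (w : List Bool) (hw : w.length ≤ S.n) (h : w ∈ Fac S.W) :
    ∃ x ∈ S.W, ∃ y ∈ S.W, w <:+: x ++ y := by
  obtain ⟨bs, hb, s, t, e⟩ := h
  exact short_aux S.W S.n S.len S.ne w hw t bs s hb e

theorem FSt.long (S : FSt) (w : List Bool) (hw : 2 * S.n ≤ w.length) (h : w ∈ Fac S.W) :
    ∃ x ∈ S.W, x <:+: w := by
  obtain ⟨bs, hb, s, t, e⟩ := h
  exact long_aux S.W S.n S.len S.pos w hw t bs s hb e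

theorem exp_beats (a b : ℕ) : ∃ m, 1 ≤ m ∧ a + b * m < 2 ^ m := by
  refine ⟨2 * (a + 2 * b + 1), by omega, ?_⟩
  have h : a + 2 * b + 1 < 2 ^ (a + 2 * b + 1) := Nat.lt_two_pow_self
  rw [two_mul, pow_add]
  set c := a + 2 * b + 1 with hc
  have : c * c < 2 ^ c * 2 ^ c := Nat.mul_lt_mul_of_lt_of_lt h h
  have h2 : a + b * (c + c) ≤ c * c := by
    have : c * c = (a + 2 * b + 1) * c := by rw [← hc]
    nlinarith
  omega

theorem FSt.fin (S : FSt) : S.W.Finite :=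
  (List.finite_length_eq Bool S.n).subset S.len

theorem exists_P (S : FSt) : ∃ bs : List (List Bool), (∀ b ∈ bs, b ∈ S.W) ∧
    ∀ a ∈ S.W, ∀ b ∈ S.W, a ++ b <:+: bs.flatten := by
  classical
  let l := S.fin.toFinset.toList
  have hl : ∀ x, x ∈ l ↔ x ∈ S.W := by simp [l]
  refine ⟨l.flatMap (fun a => l.flatMap (fun b => [a, b])), ?_, ?_⟩
  · intro b hb
    simp only [List.mem_flatMap, List.mem_cons, List.not_mem_nil, or_false, hl] at hb
    obtain ⟨x, hx, y, hy, h | h⟩ := hb <;> simp [h, hx, hy]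
  · intro a ha b hb
    have key : [a, b] <:+: l.flatMap (fun a => l.flatMap (fun b => [a, b])) := by
      refine List.IsInfix.trans (l₂ := l.flatMap (fun b => [a, b])) ?_ ?_
      · exact List.infix_of_mem_flatten (List.mem_map.2 ⟨b, (hl b).2 hb, rfl⟩)
      · exact List.infix_of_mem_flatten (List.mem_map.2 ⟨a, (hl a).2 ha, rfl⟩)
    obtain ⟨s, t, h⟩ := key
    refine ⟨s.flatten, t.flatten, ?_⟩
    rw [← h]; simp

theorem map_flatten_inj (c : Bool → List Bool) (n : ℕ) (hc : ∀ b, (c b).length = n)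
    (hi : Function.Injective c) : ∀ u v : List Bool, u.length = v.length →
    (u.map c).flatten = (v.map c).flatten → u = v := by
  intro u
  induction u with
  | nil => intro v h _; simpa using h.symm
  | cons a u ih =>
    intro v h e
    cases v with
    | nil => simp at h
    | cons b v =>
      simp only [List.map_cons, List.flatten_cons] at e
      obtain ⟨h1, h2⟩ := List.append_inj e (by rw [hc, hc])
      rw [hi h1, ih v (by simpa using h) h2]

theorem count_ge (S : FSt) : S.W.ncard ≤ {w ∈ Fac S.W | w.length = S.n}.ncard := by
  apply Set.ncard_le_ncard
  · intro x hx
    exact ⟨⟨[x], by simpa using hx, by simp⟩, S.len x hx⟩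
  · exact (List.finite_length_eq Bool S.n).subset (fun x hx => hx.2)

theorem count_le (S : FSt) (h2 : S.W.ncard ≤ 2) :
    {w ∈ Fac S.W | w.length = S.n}.ncard ≤ 4 * (S.n + 1) := by
  classical
  let F := (S.fin.toFinset ×ˢ S.fin.toFinset) ×ˢ Finset.range (S.n + 1)
  let g : (List Bool × List Bool) × ℕ → List Bool := fun p => ((p.1.1 ++ p.1.2).drop p.2).take S.n
  have hsub : {w ∈ Fac S.W | w.length = S.n} ⊆ ((F.image g : Finset (List Bool)) : Set (List Bool)) := by
    rintro w ⟨hw, hl⟩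
    obtain ⟨x, hx, y, hy, s, t, e⟩ := S.short w hl.le hw
    have hlen := congrArg List.length e
    simp [S.len x hx, S.len y hy] at hlen
    simp only [Finset.coe_image, Set.mem_image, Finset.mem_coe]
    refine ⟨((x, y), s.length), ?_, ?_⟩
    · simp [F, hx, hy]; omega
    · simp only [g]
      rw [← e, List.append_assoc, List.drop_left, List.take_left' hl]
  have hcard : S.fin.toFinset.card ≤ 2 := by
    rw [← Set.ncard_eq_toFinset_card S.W S.fin]; exact h2
  calc _ ≤ ((F.image g : Finset (List Bool)) : Set (List Bool)).ncard :=
        Set.ncard_le_ncard hsub (Finset.finite_toSet _)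
    _ = (F.image g).card := Set.ncard_coe_finset _
    _ ≤ F.card := Finset.card_image_le
    _ = S.fin.toFinset.card * S.fin.toFinset.card * (S.n + 1) := by simp [F]
    _ ≤ 4 * (S.n + 1) := Nat.mul_le_mul_right _ (by nlinarith)

theorem step (S : FSt) : ∃ T : Bool → FSt, (∀ b, Refines S (T b)) ∧
    (T true).n = (T false).n ∧
    {w ∈ Fac (T false).W | w.length = (T false).n}.ncard <
      {w ∈ Fac (T true).W | w.length = (T true).n}.ncard := by
  obtain ⟨A, hA, B, hB, hAB⟩ := S.two
  obtain ⟨ps, hps, hP⟩ := exists_P S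
  obtain ⟨m, hm1, hm⟩ := exp_beats (4 * (ps.flatten.length + 1)) (4 * S.n)
  let c : Bool → List Bool := fun b => if b then A else B
  have hcW : ∀ b, c b ∈ S.W := by intro b; cases b <;> simp [c, hA, hB]
  have hc : ∀ b, (c b).length = S.n := fun b => S.len _ (hcW b)
  have hi : Function.Injective c := by
    intro a b; cases a <;> cases b <;> simp [c, hAB, hAB.symm]
  let g : List Bool → List Bool := fun v => ps.flatten ++ (v.map c).flatten
  have hg : Set.InjOn g {v | v.length = m} := by
    intro u hu v hv e
    exact map_flatten_inj c S.n hc hi u v (by rw [hu, hv]) (List.append_cancel_left e)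
  have hgl : ∀ v : List Bool, v.length = m → (g v).length = ps.flatten.length + m * S.n := by
    intro v hv
    have : ∀ v : List Bool, (v.map c).flatten.length = v.length * S.n := by
      intro v
      induction v with
      | nil => simp
      | cons a v ih =>
        rw [List.map_cons, List.flatten_cons, List.length_append, ih, hc, List.length_cons]; ring
    simp only [g]
    rw [List.length_append, this, hv]
  let V : Bool → Set (List Bool) := fun b =>
    if b then {v | v.length = m} else {List.replicate m true, List.replicate m false}
  have hV : ∀ b, ∀ v ∈ V b, v.length = m := by
    intro b v hv
    cases b
    · simp [V] at hv
      rcases hv with rfl | rfl <;> simp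
    · simpa [V] using hv
  have hVt : ∀ b x, List.replicate m x ∈ V b := by
    intro b x
    cases b <;> cases x <;> simp [V]
  let T : Bool → FSt := fun b =>
    { W := g '' V b
      n := ps.flatten.length + m * S.n
      pos := by have := Nat.mul_le_mul hm1 S.pos; omega
      len := by rintro x ⟨v, hv, rfl⟩; exact hgl v (hV b v hv)
      two := by
        refine ⟨_, ⟨_, hVt b true, rfl⟩, _, ⟨_, hVt b false, rfl⟩, ?_⟩
        intro e
        have := hg (by simp) (by simp) e
        rw [List.replicate_right_inj (by omega)] at this
        simp at this }
  refine ⟨T, ?_, rfl, ?_⟩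
  · intro b
    constructor
    · rintro x ⟨v, hv, rfl⟩
      refine ⟨ps ++ v.map c, ?_, by simp [g]⟩
      intro y hy
      rcases List.mem_append.1 hy with h | h
      · exact hps y h
      · obtain ⟨z, _, rfl⟩ := List.mem_map.1 h
        exact hcW z
    · rintro x ⟨v, hv, rfl⟩ a ha b hb
      exact List.infix_append_of_infix_left (hP a ha b hb)
  · have h1 := count_ge (T true)
    have h2 : (T true).W.ncard = 2 ^ m := by
      change (g '' {v | v.length = m}).ncard = _
      rw [hg.ncard_image]
      have : Nat.card (List.Vector Bool m) = 2 ^ m := by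
        rw [Nat.card_eq_fintype_card, card_vector]; simp
      exact this
    have h3 := count_le (T false) (by
      have hVf : V false = {List.replicate m true, List.replicate m false} := by simp [V]
      change (g '' V false).ncard ≤ 2
      rw [hVf]
      refine (Set.ncard_image_le (Set.toFinite _)).trans ?_
      refine (Set.ncard_insert_le _ _).trans ?_
      simp)
    have h4 : (T false).n = ps.flatten.length + m * S.n := rfl
    rw [h4] at h3
    rw [h2] at h1
    refine lt_of_le_of_lt h3 (lt_of_lt_of_le ?_ h1)
    calc _ = 4 * (ps.flatten.length + 1) + 4 * S.n * m := by ring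
      _ < _ := hm

noncomputable def nxt (S : FSt) : Bool → FSt := (step S).choose

def S0 : FSt where
  W := {[true], [false]}
  n := 1
  pos := le_rfl
  len := by rintro x (rfl | rfl) <;> rfl
  two := ⟨[true], by simp, [false], by simp, by simp⟩

noncomputable def stSeq (x : ℕ → Bool) : ℕ → FSt
  | 0 => S0
  | k + 1 => nxt (stSeq x k) (x k)

def Lg (x : ℕ → Bool) : Set (List Bool) := {w | ∀ k, w ∈ Fac (stSeq x k).W}

theorem sq_ref (x : ℕ → Bool) (k : ℕ) : Refines (stSeq x k) (stSeq x (k + 1)) :=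
  (step (stSeq x k)).choose_spec.1 (x k)

theorem fac_anti {S T : FSt} (h : Refines S T) : Fac T.W ⊆ Fac S.W := by
  rintro w ⟨bs, hb, hw⟩
  have : ∀ bs : List (List Bool), (∀ b ∈ bs, b ∈ T.W) →
      ∃ cs : List (List Bool), (∀ b ∈ cs, b ∈ S.W) ∧ bs.flatten = cs.flatten := by
    intro bs
    induction bs with
    | nil => intro _; exact ⟨[], by simp, rfl⟩
    | cons b bs ih =>
      intro hb
      obtain ⟨cs, h1, h2⟩ := ih (fun c hc => hb c (by simp [hc]))
      obtain ⟨ds, h3, h4⟩ := h.1 b (hb b (by simp))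
      refine ⟨ds ++ cs, ?_, by simp [h2, h4]⟩
      intro y hy
      rcases List.mem_append.1 hy with h | h
      · exact h3 y h
      · exact h1 y h
  obtain ⟨cs, h1, h2⟩ := this bs hb
  exact ⟨cs, h1, h2 ▸ hw⟩

theorem sq_n (x : ℕ → Bool) (k : ℕ) : k < (stSeq x k).n := by
  induction k with
  | zero => exact (stSeq x 0).pos
  | succ k ih =>
    obtain ⟨y, hy⟩ := (stSeq x (k+1)).ne
    obtain ⟨a, ha⟩ := (stSeq x k).ne
    have h := ((sq_ref x k).2 y hy a ha a ha).length_le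
    rw [List.length_append, (stSeq x k).len a ha, (stSeq x (k+1)).len y hy] at h
    omega

theorem short_all (x : ℕ → Bool) (k : ℕ) (w : List Bool) (hw : w ∈ Fac (stSeq x k).W)
    (hl : w.length ≤ (stSeq x k).n) (j : ℕ) : ∀ y ∈ (stSeq x (k + 1 + j)).W, w <:+: y := by
  induction j with
  | zero =>
    intro y hy
    obtain ⟨a, ha, b, hb, h⟩ := (stSeq x k).short w hl hw
    exact h.trans ((sq_ref x k).2 y hy a ha b hb)
  | succ j ih =>
    intro y hy
    obtain ⟨a, ha⟩ := (stSeq x (k + 1 + j)).ne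
    exact (ih a ha).trans (List.infix_append_left.trans ((sq_ref x (k + 1 + j)).2 y hy a ha a ha))

theorem short_mem (x : ℕ → Bool) (k : ℕ) (w : List Bool) (hw : w ∈ Fac (stSeq x k).W)
    (hl : w.length ≤ (stSeq x k).n) : w ∈ Lg x := by
  have anti : Antitone (fun k => Fac (stSeq x k).W) :=
    antitone_nat_of_succ_le (fun k => fac_anti (sq_ref x k))
  intro j
  have hbig : w ∈ Fac (stSeq x (k + 1 + j)).W := by
    obtain ⟨a, ha⟩ := (stSeq x (k + 1 + j)).ne
    exact ⟨[a], by simpa using ha, by simpa using short_all x k w hw hl j a ha⟩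
  exact anti (show j ≤ k + 1 + j by omega) hbig

theorem Lg_count (x : ℕ → Bool) (k : ℕ) :
    {w ∈ Lg x | w.length = (stSeq x k).n} = {w ∈ Fac (stSeq x k).W | w.length = (stSeq x k).n} := by
  ext w
  constructor
  · rintro ⟨h, hl⟩; exact ⟨h k, hl⟩
  · rintro ⟨h, hl⟩; exact ⟨short_mem x k w h hl.le, hl⟩

theorem Lg_rec (x : ℕ → Bool) (u : List Bool) (hu : u ∈ Lg x) :
    ∃ N, ∀ v ∈ Lg x, N ≤ v.length → u <:+: v := by
  refine ⟨2 * (stSeq x (u.length + 1)).n, fun v hv hN => ?_⟩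
  obtain ⟨y, hy, hyv⟩ := (stSeq x (u.length + 1)).long v hN (hv _)
  exact (short_all x u.length u (hu _) (sq_n x _).le 0 y hy).trans hyv

theorem Lg_ne (x y : ℕ → Bool) (h : x ≠ y) :
    ∃ n, Set.ncard {w ∈ Lg x | w.length = n} ≠ Set.ncard {w ∈ Lg y | w.length = n} := by
  classical
  have hex : ∃ k, x k ≠ y k := by
    by_contra hc
    push Not at hc
    exact h (funext hc)
  let k := Nat.find hex
  have hk : x k ≠ y k := Nat.find_spec hex
  have hlt : ∀ j < k, x j = y j := fun j hj => not_not.1 (Nat.find_min hex hj)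
  have hs : ∀ j ≤ k, stSeq x j = stSeq y j := by
    intro j
    induction j with
    | zero => intro _; rfl
    | succ j ih =>
      intro hj
      simp only [stSeq]
      rw [ih (by omega), hlt j (by omega)]
  have hsk := hs k le_rfl
  obtain ⟨-, h2, h3⟩ := (step (stSeq x k)).choose_spec
  have e1 : stSeq x (k+1) = (step (stSeq x k)).choose (x k) := rfl
  have e2 : stSeq y (k+1) = (step (stSeq x k)).choose (y k) := by rw [hsk]; rfl
  have c1 := Lg_count x (k+1)
  have c2 := Lg_count y (k+1)
  rw [e1] at c1
  rw [e2] at c2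
  refine ⟨((step (stSeq x k)).choose true).n, ?_⟩
  cases hx : x k <;> cases hy : y k
  · simp [hx, hy] at hk
  · rw [hx, ← h2] at c1; rw [hy] at c2; rw [c1, c2]
    rw [← h2] at h3
    exact h3.ne
  · rw [hx] at c1; rw [hy, ← h2] at c2; rw [c1, c2]
    rw [← h2] at h3
    exact h3.ne'
  · simp [hx, hy] at hk

theorem uncountable_wqo_factor_closed_languages :
    ∃ 𝔏 : Set (Set (List Bool)),
      ¬ 𝔏.Countable ∧
      (∀ L ∈ 𝔏, ∀ w ∈ L, ∀ u : List Bool, u <:+: w → u ∈ L) ∧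
      (∀ L ∈ 𝔏, ∀ f : ℕ → List Bool, (∀ n, f n ∈ L) → ∃ m n, m < n ∧ f m <:+: f n) ∧
      (∀ L ∈ 𝔏, ∀ L' ∈ 𝔏, L ≠ L' →
        ∃ n, Set.ncard {w ∈ L | w.length = n} ≠ Set.ncard {w ∈ L' | w.length = n}) := by
  refine ⟨Set.range Lg, ?_, ?_, ?_, ?_⟩
  · intro hc
    have hinj : Function.Injective Lg := by
      intro x y e
      by_contra h
      obtain ⟨n, hn⟩ := Lg_ne x y h
      exact hn (by rw [e])
    have h1 : Countable (ℕ → Bool) := by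
      have := hc.to_subtype
      exact (Set.rangeFactorization_injective.2 hinj).countable
    have h2 : Countable (Set ℕ) := by
      classical
      refine Function.Injective.countable (f := fun (s : Set ℕ) (n : ℕ) => decide (n ∈ s)) ?_
      intro s t e
      ext n
      simpa using congrFun e n
    obtain ⟨f, hf⟩ := exists_injective_nat (Set ℕ)
    exact Function.cantor_injective f hf
  · rintro _ ⟨x, rfl⟩ w hw u hu k
    obtain ⟨bs, hb, h⟩ := hw k
    exact ⟨bs, hb, hu.trans h⟩
  · rintro _ ⟨x, rfl⟩ f hf
    obtain ⟨N, hN⟩ := Lg_rec x (f 0) (hf 0)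
    by_cases h : ∃ n, 0 < n ∧ N ≤ (f n).length
    · obtain ⟨n, h0, hn⟩ := h
      exact ⟨0, n, h0, hN _ (hf n) hn⟩
    · push Not at h
      have hfin : {l : List Bool | l.length < N}.Finite := List.finite_length_lt Bool N
      have hmap : Set.MapsTo f (Set.Ioi 0) {l : List Bool | l.length < N} := fun n hn => h n hn
      obtain ⟨a, _, b, _, hab, e⟩ :=
        (Set.Ioi_infinite (0 : ℕ)).exists_ne_map_eq_of_mapsTo hmap hfin
      rcases lt_or_gt_of_ne hab with h | h
      · exact ⟨a, b, h, by rw [e]⟩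
      · exact ⟨b, a, h, by rw [e]⟩
  · rintro _ ⟨x, rfl⟩ _ ⟨y, rfl⟩ h
    exact Lg_ne x y (fun e => h (by rw [e]))
end

section
/- For every sequence (s_k) of positive integers there exists an infinite binary sequence W : ℕ → Bool such that: (a) for every i ≥ 1, the prefix of W of length |α_i^{(s)}| equals α_i^{(s)} (i.e. List.ofFn (fun k : Fin |α_i^{(s)}| => W k) = α_i^{(s)}); and (b) a finite binary word u is a factor of W — meaning there exists p with u = List.ofFn (fun k : Fin u.length => W (p + k)) — if and only if u ∈ L^{(s)}. -/
theorem aux_prefix_succ (s : ℕ → ℕ) (hs : ∀ k, 0 < s k) (i : ℕ) :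
    alphaWord s i <+: alphaWord s (i + 1) := by
  cases i with
  | zero => exact List.nil_prefix
  | succ i =>
    obtain ⟨m, hm⟩ := Nat.exists_eq_succ_of_ne_zero (hs (i + 1)).ne'
    show _ <+: wordPow _ _ ++ _
    rw [hm, wordPow, List.replicate_succ, List.flatten_cons, List.append_assoc]
    exact List.prefix_append _ _

theorem aux_prefix (s : ℕ → ℕ) (hs : ∀ k, 0 < s k) {i j : ℕ} (h : i ≤ j) :
    alphaWord s i <+: alphaWord s j := by
  induction h with
  | refl => exact List.prefix_refl _
  | step _ ih => exact ih.trans (aux_prefix_succ s hs _)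

theorem aux_length (s : ℕ → ℕ) (hs : ∀ k, 0 < s k) (i : ℕ) :
    i ≤ (alphaWord s i).length := by
  induction i with
  | zero => simp
  | succ i ih =>
    cases i with
    | zero => simp [alphaWord]
    | succ i =>
      have h := hs (i + 1)
      simp only [alphaWord, wordPow, wordCompl, List.length_append, List.length_flatten,
        List.map_replicate, List.sum_replicate, List.length_map, smul_eq_mul]
      nlinarith

theorem exists_infinite_word_with_langL_factors (s : ℕ → ℕ) (hs : ∀ k, 0 < s k) :
    ∃ W : ℕ → Bool,
      (∀ i, 1 ≤ i →
        List.ofFn (fun k : Fin (alphaWord s i).length => W k) = alphaWord s i) ∧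
      (∀ u : List Bool,
        (∃ p, u = List.ofFn (fun k : Fin u.length => W (p + k))) ↔ u ∈ langL s) := by
  have key : ∀ i k (h : k < (alphaWord s i).length),
      (alphaWord s (k + 1)).getD k false = (alphaWord s i)[k] := by
    intro i k h
    have h1 : k < (alphaWord s (k + 1)).length := aux_length s hs (k + 1)
    rw [List.getD_eq_getElem _ _ h1]
    rcases le_total i (k + 1) with hle | hle
    · exact ((aux_prefix s hs hle).getElem h).symm
    · exact (aux_prefix s hs hle).getElem h1
  refine ⟨fun k => (alphaWord s (k + 1)).getD k false, ?_, ?_⟩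
  · intro i _
    apply List.ext_getElem
    · simp
    · intro k h1 h2
      rw [List.getElem_ofFn]
      exact key i k h2
  · intro u
    constructor
    · rintro ⟨p, hp⟩
      have hl := aux_length s hs (p + u.length + 1)
      refine ⟨p + u.length + 1, by omega, ?_⟩
      have : u = ((alphaWord s (p + u.length + 1)).drop p).take u.length := by
        apply List.ext_getElem
        · simp; omega
        · intro k h1 h2
          have e : u[k] = (List.ofFn (fun k : Fin u.length =>
              (alphaWord s (p + k + 1)).getD (p + k) false))[k]'(by simpa using h1) :=
            List.getElem_of_eq hp h1
          rw [e, List.getElem_ofFn, List.getElem_take, List.getElem_drop]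
          exact key _ _ _
      have h2 : ((alphaWord s (p + u.length + 1)).drop p).take u.length <:+:
          alphaWord s (p + u.length + 1) :=
        (List.take_prefix _ _).isInfix.trans (List.drop_suffix _ _).isInfix
      rwa [← this] at h2
    · rintro ⟨i, _, x, y, h⟩
      refine ⟨x.length, ?_⟩
      apply List.ext_getElem
      · simp
      · intro k h1 h2
        rw [List.getElem_ofFn]
        have hlt : x.length + k < (alphaWord s i).length := by
          rw [← h]; simp; omega
        refine Eq.trans ?_ (key i (x.length + k) hlt).symm
        simp [← h, h1]
end

section
/- There exists an uncountable set 𝒲 of infinite binary sequences (𝒲 : Set (ℕ → Bool), ¬ 𝒲.Countable) such that: any two distinct W, W' ∈ 𝒲 have distinct complexity functions, i.e. there exists n with p_W(n) ≠ p_{W'}(n); and moreover every W ∈ 𝒲 has complexity at most linear, namely p_W(n) ≤ 8n for all n ≥ 1. -/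
/-- A finite binary word `u` is a factor of an infinite sequence `W : ℕ → Bool` if it
occurs contiguously at some position `p`. -/
def IsFactorOfSeq (u : List Bool) (W : ℕ → Bool) : Prop :=
  ∃ p, u = List.ofFn (fun k : Fin u.length => W (p + k))

/-- The complexity function of an infinite binary sequence: the number of distinct
factors of each length. -/
noncomputable def complexity (W : ℕ → Bool) (n : ℕ) : ℕ :=
  Set.ncard {u : List Bool | u.length = n ∧ IsFactorOfSeq u W}

def winW (W : ℕ → Bool) (n p : ℕ) : List Bool := List.ofFn (fun k : Fin n => W (p + k))

def sgl (n i : ℕ) : List Bool := List.ofFn (fun k : Fin n => decide (k.val = i))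

lemma winW_eq_iff (W W' : ℕ → Bool) (n p q : ℕ) :
    winW W n p = winW W' n q ↔ ∀ k < n, W (p + k) = W' (q + k) := by
  unfold winW
  rw [List.ofFn_inj, funext_iff]
  exact ⟨fun h k hk => h ⟨k, hk⟩, fun h k => h k k.2⟩

lemma winW_eq_sgl (W : ℕ → Bool) (n p i : ℕ) :
    winW W n p = sgl n i ↔ ∀ k < n, W (p + k) = decide (k = i) := by
  unfold winW sgl
  rw [List.ofFn_inj, funext_iff]
  exact ⟨fun h k hk => h ⟨k, hk⟩, fun h k => h k k.2⟩

lemma factors_eq (W : ℕ → Bool) (n : ℕ) :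
    {u : List Bool | u.length = n ∧ IsFactorOfSeq u W} = Set.range (winW W n) := by
  ext u
  simp only [Set.mem_setOf_eq, Set.mem_range, IsFactorOfSeq]
  constructor
  · rintro ⟨rfl, p, hp⟩
    exact ⟨p, hp.symm⟩
  · rintro ⟨p, rfl⟩
    have hl : (winW W n p).length = n := by simp [winW]
    refine ⟨hl, p, ?_⟩
    apply List.ext_getElem
    · simp
    · intro i h1 h2
      simp [winW]

lemma range_finite (W : ℕ → Bool) (n : ℕ) : (Set.range (winW W n)).Finite := by
  apply (List.finite_length_eq Bool n).subset
  rintro _ ⟨p, rfl⟩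
  simp [winW]

lemma exists_sgl (W : ℕ → Bool) (n p : ℕ)
    (h : ∀ x y, p ≤ x → x < y → y < p + n → W x = true → W y = true → False) :
    ∃ i ≤ n, winW W n p = sgl n i := by
  by_cases hz : ∃ i < n, W (p + i) = true
  · obtain ⟨i, hi, hW⟩ := hz
    refine ⟨i, hi.le, (winW_eq_sgl _ _ _ _).2 fun k hk => ?_⟩
    rcases lt_trichotomy k i with hki | rfl | hki
    · have := h (p + k) (p + i) (by omega) (by omega) (by omega)
      have h2 : k ≠ i := by omega
      cases hc : W (p + k) <;> simp_all
    · simp [hW]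
    · have := h (p + i) (p + k) (by omega) (by omega) (by omega)
      have h2 : k ≠ i := by omega
      cases hc : W (p + k) <;> simp_all
  · push Not at hz
    refine ⟨n, le_rfl, (winW_eq_sgl _ _ _ _).2 fun k hk => ?_⟩
    have := hz k hk
    have h2 : k ≠ n := by omega
    simp_all

def tt (f : ℕ → Bool) : ℕ → ℕ
  | 0 => 0
  | k + 1 => 4 ^ (k + 1) + (f k).toNat

lemma tt_le (f : ℕ → Bool) (k : ℕ) : tt f k ≤ 4 ^ k + 1 := by
  cases k with
  | zero => simp [tt]
  | succ k => have := Bool.toNat_le (f k); simp only [tt]; omega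

lemma le_tt (f : ℕ → Bool) (k : ℕ) : 4 ^ (k + 1) ≤ tt f (k + 1) := by
  simp [tt]

lemma tt_succ (f : ℕ → Bool) (k : ℕ) : tt f k + 3 * 4 ^ k ≤ tt f (k + 1) + 1 := by
  have := tt_le f k
  have := le_tt f k
  rw [pow_succ] at this
  omega

lemma tt_strictMono (f : ℕ → Bool) : StrictMono (tt f) := by
  apply strictMono_nat_of_lt_succ
  intro k
  have := tt_succ f k
  have : 0 < 4 ^ k := by positivity
  omega

lemma tt_gap (f : ℕ → Bool) {i j : ℕ} (h : i < j) : tt f i + 3 * 4 ^ i ≤ tt f j + 1 := by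
  have := tt_succ f i
  have := (tt_strictMono f).monotone (Nat.succ_le_of_lt h)
  simp only [Nat.succ_eq_add_one] at this
  omega

open Classical in
noncomputable def seqW (f : ℕ → Bool) (n : ℕ) : Bool := decide (∃ k, tt f k = n)

lemma seqW_iff (f : ℕ → Bool) (n : ℕ) : seqW f n = true ↔ ∃ k, tt f k = n := by
  simp [seqW]

lemma seqW_bound (f : ℕ → Bool) (n : ℕ) (hn : 1 ≤ n) : complexity (seqW f) n ≤ 8 * n := by
  obtain ⟨k, hk, hM⟩ : ∃ k, n ≤ 4 ^ k ∧ tt f k ≤ 4 * n := by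
    have hex : ∃ k, n ≤ 4 ^ k := ⟨n, (Nat.lt_pow_self (by norm_num)).le⟩
    classical
    refine ⟨Nat.find hex, Nat.find_spec hex, ?_⟩
    rcases hc : Nat.find hex with _ | m
    · simp [tt]
    · have := Nat.find_min hex (m := m) (by omega)
      have h2 := tt_le f (m + 1)
      rw [pow_succ] at h2
      omega
  have hsub : Set.range (winW (seqW f) n) ⊆
      (((Finset.range (tt f k)).image (winW (seqW f) n) ∪
        (Finset.range (n + 1)).image (sgl n) : Finset (List Bool)) : Set (List Bool)) := by
    rintro _ ⟨p, rfl⟩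
    simp only [Finset.coe_union, Set.mem_union, Finset.mem_coe, Finset.mem_image,
      Finset.mem_range]
    by_cases hp : p < tt f k
    · exact Or.inl ⟨p, hp, rfl⟩
    · right
      obtain ⟨i, hi, he⟩ := exists_sgl (seqW f) n p (by
        intro x y hx hxy hy h1 h2
        obtain ⟨i, rfl⟩ := (seqW_iff f x).1 h1
        obtain ⟨j, rfl⟩ := (seqW_iff f y).1 h2
        have hij := (tt_strictMono f).lt_iff_lt.1 hxy
        have hki : k ≤ i := (tt_strictMono f).le_iff_le.1 (by omega)
        have := tt_gap f hij
        have : 4 ^ k ≤ 4 ^ i := Nat.pow_le_pow_right (by norm_num) hki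
        omega)
      exact ⟨i, by omega, he.symm⟩
  unfold complexity
  rw [factors_eq]
  have h1 := Set.ncard_le_ncard hsub (Finset.finite_toSet _)
  rw [Set.ncard_coe_finset] at h1
  have h2 := Finset.card_union_le ((Finset.range (tt f k)).image (winW (seqW f) n))
    ((Finset.range (n + 1)).image (sgl n))
  have h3 : ((Finset.range (tt f k)).image (winW (seqW f) n)).card ≤ _ := Finset.card_image_le
  have h4 : ((Finset.range (n + 1)).image (sgl n)).card ≤ _ := Finset.card_image_le
  rw [Finset.card_range] at h3 h4
  omega

lemma sgl_mem (f : ℕ → Bool) (k n i : ℕ) (hn : n ≤ 4 ^ (k + 1) + 1) (hi : i ≤ n) :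
    sgl n i ∈ Set.range (winW (seqW f) n) := by
  have hpos : 0 < 4 ^ k := by positivity
  have e1 : 4 ^ (k + 1) = 4 * 4 ^ k := by ring
  have e2 : 4 ^ (k + 2) = 16 * 4 ^ k := by ring
  have key : ∀ m, tt f m = tt f (k + 2) ∨ tt f m + n ≤ tt f (k + 2) ∨
      tt f (k + 2) + n < tt f m := by
    intro m
    rcases lt_trichotomy m (k + 2) with h | rfl | h
    · right; left
      have := (tt_strictMono f).monotone (Nat.le_of_lt_succ h)
      have := tt_gap f (show k + 1 < k + 2 by omega)
      omega
    · exact Or.inl rfl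
    · right; right
      have := tt_gap f h
      omega
  have hbig : n ≤ tt f (k + 2) := by
    have := le_tt f (k + 1)
    simp only [add_assoc, Nat.reduceAdd] at this
    omega
  rcases hi.lt_or_eq with hi | rfl
  · refine ⟨tt f (k + 2) - i, (winW_eq_sgl _ _ _ _).2 fun j hj => ?_⟩
    rw [Bool.eq_iff_iff, seqW_iff, decide_eq_true_iff]
    constructor
    · rintro ⟨m, hm⟩
      have := key m
      omega
    · rintro rfl
      exact ⟨k + 2, by omega⟩
  · refine ⟨tt f (k + 2) + 1, (winW_eq_sgl _ _ _ _).2 fun j hj => ?_⟩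
    rw [Bool.eq_iff_iff, seqW_iff, decide_eq_true_iff]
    constructor
    · rintro ⟨m, hm⟩
      have := key m
      omega
    · rintro rfl
      omega

lemma complexity_lt (f g : ℕ → Bool) (k : ℕ) (hlt : ∀ j < k, f j = g j)
    (hf : f k = false) (hg : g k = true) :
    ∃ n, complexity (seqW g) n < complexity (seqW f) n := by
  have hpos : 0 < 4 ^ k := by positivity
  have e1 : 4 ^ (k + 1) = 4 * 4 ^ k := by ring
  have hle : ∀ j ≤ k, tt f j = tt g j := by
    intro j hj
    cases j with
    | zero => rfl
    | succ j => simp only [tt]; rw [hlt j (by omega)]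
  have hfk : tt f (k + 1) = 4 ^ (k + 1) := by simp [tt, hf]
  have hgk : tt g (k + 1) = 4 ^ (k + 1) + 1 := by simp [tt, hg]
  have hk := hle k le_rfl
  have hkle := tt_le f k
  obtain ⟨a, ha⟩ : ∃ a, tt f k + a = 4 ^ (k + 1) := ⟨4 ^ (k + 1) - tt f k, by omega⟩
  have hgap : ∀ i j, k ≤ i → i < j → tt g i + a + 1 ≤ tt g j := by
    intro i j hki hij
    rcases hki.eq_or_lt with rfl | hki
    · have := (tt_strictMono g).monotone (Nat.succ_le_of_lt hij)
      simp only [Nat.succ_eq_add_one] at this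
      omega
    · have := tt_gap g hij
      have : 4 ^ (k + 1) ≤ 4 ^ i := Nat.pow_le_pow_right (by norm_num) hki
      omega
  refine ⟨a + 1, ?_⟩
  unfold complexity
  rw [factors_eq, factors_eq]
  apply Set.ncard_lt_ncard _ (range_finite _ _)
  rw [Set.ssubset_iff_of_subset]
  · refine ⟨winW (seqW f) (a + 1) (tt f k), ⟨_, rfl⟩, ?_⟩
    rintro ⟨q, hq⟩
    rw [winW_eq_iff] at hq
    have h0 := hq 0 (by omega)
    have h1 := hq a (by omega)
    rw [(seqW_iff f (tt f k + 0)).2 ⟨k, rfl⟩, seqW_iff] at h0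
    rw [(seqW_iff f (tt f k + a)).2 ⟨k + 1, by omega⟩, seqW_iff] at h1
    obtain ⟨i, hi⟩ := h0
    obtain ⟨j, hj⟩ := h1
    have hij : i < j := (tt_strictMono g).lt_iff_lt.1 (by omega)
    by_cases hki : k ≤ i
    · have := hgap i j hki hij
      omega
    · have h1 := (tt_strictMono g) (show i < k by omega)
      have hjk : j < k + 1 := (tt_strictMono g).lt_iff_lt.1 (by omega)
      have h2 := (tt_strictMono g).monotone (Nat.le_of_lt_succ hjk)
      have h3 : 4 ^ 1 ≤ 4 ^ k := Nat.pow_le_pow_right (by norm_num) (by omega)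
      omega
  · rintro _ ⟨p, rfl⟩
    by_cases hp : p + (a + 1) ≤ 4 ^ (k + 1)
    · refine ⟨p, (winW_eq_iff _ _ _ _ _).2 fun m hm => ?_⟩
      rw [Bool.eq_iff_iff, seqW_iff, seqW_iff]
      constructor
      · rintro ⟨j, hj⟩
        have : j < k + 1 := (tt_strictMono f).lt_iff_lt.1 (by omega)
        exact ⟨j, by rw [← hle j (by omega), hj]⟩
      · rintro ⟨j, hj⟩
        have : j < k + 1 := (tt_strictMono g).lt_iff_lt.1 (by omega)
        exact ⟨j, by rw [hle j (by omega), hj]⟩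
    · obtain ⟨i, hi, he⟩ := exists_sgl (seqW g) (a + 1) p (by
        intro x y hx hxy hy h1 h2
        obtain ⟨i, rfl⟩ := (seqW_iff g x).1 h1
        obtain ⟨j, rfl⟩ := (seqW_iff g y).1 h2
        have hij := (tt_strictMono g).lt_iff_lt.1 hxy
        have hki : k ≤ i := (tt_strictMono g).le_iff_le.1 (by omega)
        have := hgap i j hki hij
        omega)
      rw [he]
      exact sgl_mem f k _ i (by omega) hi

lemma complexity_ne (f g : ℕ → Bool) (h : f ≠ g) :
    ∃ n, complexity (seqW f) n ≠ complexity (seqW g) n := by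
  classical
  have hex : ∃ k, f k ≠ g k := Function.ne_iff.1 h
  have hs := Nat.find_spec hex
  have hm : ∀ j < Nat.find hex, f j = g j := fun j hj => not_not.1 (Nat.find_min hex hj)
  cases hf : f (Nat.find hex) <;> cases hg : g (Nat.find hex)
  · simp [hf, hg] at hs
  · obtain ⟨n, hn⟩ := complexity_lt f g _ hm hf hg
    exact ⟨n, hn.ne'⟩
  · obtain ⟨n, hn⟩ := complexity_lt g f _ (fun j hj => (hm j hj).symm) hg hf
    exact ⟨n, hn.ne⟩
  · simp [hf, hg] at hs

theorem uncountably_many_distinct_complexity_functions :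
    ∃ 𝒲 : Set (ℕ → Bool),
      ¬ 𝒲.Countable ∧
      (∀ W ∈ 𝒲, ∀ W' ∈ 𝒲, W ≠ W' → ∃ n, complexity W n ≠ complexity W' n) ∧
      (∀ W ∈ 𝒲, ∀ n, 1 ≤ n → complexity W n ≤ 8 * n) := by
  refine ⟨Set.range seqW, ?_, ?_, ?_⟩
  · intro hc
    have hinj : Function.Injective seqW := by
      intro f g hfg
      by_contra hne
      obtain ⟨n, hn⟩ := complexity_ne f g hne
      exact hn (by rw [hfg])
    have h1 : Countable (Set.range seqW) := hc.to_subtype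
    have h2 : Countable (ℕ → Bool) :=
      (Equiv.ofInjective seqW hinj).injective.countable
    have h3 : Countable (Set ℕ) := by
      classical
      refine Function.Injective.countable (f := fun (s : Set ℕ) (n : ℕ) => decide (n ∈ s)) ?_
      intro s t hst
      ext n
      have := congrFun hst n
      simpa using this
    obtain ⟨e, he⟩ := exists_injective_nat (Set ℕ)
    exact Function.cantor_injective e he
  · rintro _ ⟨f, rfl⟩ _ ⟨g, rfl⟩ hne
    exact complexity_ne f g (fun h => hne (by rw [h]))
  · rintro _ ⟨f, rfl⟩ n hn
    exact seqW_bound f n hn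
end
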